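/- arXiv:1709.09570 — 10 statements merged into one kernel-verified Lean document; each statement's English description precedes it below -/
import Mathlib

section
/- Suppose the quality dimension is one (d = 1), Z = [a,b] ⊂ ℝ is compact with nonempty interior, ζ : ℝ × Z → ℝ is twice continuously differentiable and satisfies the single-crossing (Spence–Mirlees) condition ∂²ζ/∂ε∂z(ε,z) > 0 for all (ε,z), and the price p : Z → ℝ is twice continuously differentiable on the interior of Z. If Ū₁ and Ū₂ are twice continuously differentiable functions on Z that are each compatible with the data (μ_ε, μ_z, p), then Ū₁′(z) = Ū₂′(z) for μ_z-almost every z; i.e., the marginal utility is nonparametrically identified from single-market data. -/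
open MeasureTheory Set

/-- A candidate deterministic utility `W` is *compatible* with the single-market data
`(με, μz, price)` on the quality space `[a,b]` with taste–quality surplus `ζ` if there is a
probability coupling of tastes and traded qualities, with marginals `με` and `μz`, such that
almost every traded quality lies in the interior of `[a,b]` and maximizes the consumer's
objective `z' ↦ W z' + ζ ε z' - price z'`, the supremum being finite for every taste `ε`. -/
def Compatible1D (a b : ℝ) (ζ : ℝ → ℝ → ℝ) (price : ℝ → ℝ)
    (με μz : Measure ℝ) (W : ℝ → ℝ) : Prop :=
  (∀ ε : ℝ, BddAbove ((fun z' => W z' + ζ ε z' - price z') '' Set.Icc a b)) ∧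
  ∃ γ : Measure (ℝ × ℝ), IsProbabilityMeasure γ ∧
    γ.map Prod.fst = με ∧ γ.map Prod.snd = μz ∧
    ∀ᵐ q ∂γ, q.2 ∈ interior (Set.Icc a b) ∧
      IsMaxOn (fun z' => W z' + ζ q.1 z' - price z') (Set.Icc a b) q.2

/-- If a cross derivative is positive, the function has strictly increasing differences. -/
theorem sub_lt_sub_of_cross_deriv_pos {ζ : ℝ → ℝ → ℝ}
    (hζ : ∀ ε, Differentiable ℝ (ζ ε))
    (hSC : ∀ ε z : ℝ, 0 < deriv (fun ε' => deriv (fun w => ζ ε' w) z) ε)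
    {e e' z z' : ℝ} (he : e' < e) (hz : z < z') :
    ζ e z - ζ e' z < ζ e z' - ζ e' z' := by
  have hmono : StrictMono (fun w => ζ e w - ζ e' w) := by
    refine strictMono_of_deriv_pos fun w => ?_
    have hd : deriv (fun w => ζ e w - ζ e' w) w = deriv (ζ e) w - deriv (ζ e') w :=
      deriv_fun_sub (hζ e w) (hζ e' w)
    rw [hd, sub_pos]
    exact strictMono_of_deriv_pos (fun ε => hSC ε w) he
  exact hmono hz

/-- The joint distribution function of a coupling concentrated on a monotone set is the minimum
of the marginal distribution functions. -/
theorem measure_Iic_prod_Iic_of_ae_monotone {γ : Measure (ℝ × ℝ)} {S : Set (ℝ × ℝ)}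
    (hS : ∀ᵐ q ∂γ, q ∈ S)
    (hmono : ∀ q ∈ S, ∀ r ∈ S, q.2 < r.2 → q.1 ≤ r.1) (e z : ℝ) :
    γ (Iic e ×ˢ Iic z) = min (γ.map Prod.fst (Iic e)) (γ.map Prod.snd (Iic z)) := by
  rw [Measure.map_apply measurable_fst measurableSet_Iic,
    Measure.map_apply measurable_snd measurableSet_Iic]
  refine le_antisymm (le_min (measure_mono fun q hq => hq.1) (measure_mono fun q hq => hq.2)) ?_
  by_cases h : ∀ q ∈ S, q.1 ≤ e → q.2 ≤ z
  · refine (min_le_left _ _).trans (measure_mono_ae ?_)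
    filter_upwards [hS] with q hq hqe
    exact ⟨hqe, h q hq hqe⟩
  · push Not at h
    obtain ⟨r, hr, hre, hrz⟩ := h
    refine (min_le_right _ _).trans (measure_mono_ae ?_)
    filter_upwards [hS] with q hq hqz
    exact ⟨(hmono q hq r hr (lt_of_le_of_lt hqz hrz)).trans hre, hqz⟩

/-- A finite measure on the plane is determined by its joint distribution function. -/
theorem measure_ext_of_Iic_prod_Iic {γ γ' : Measure (ℝ × ℝ)} [IsFiniteMeasure γ]
    [IsFiniteMeasure γ'] (h : ∀ e z : ℝ, γ (Iic e ×ˢ Iic z) = γ' (Iic e ×ˢ Iic z)) :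
    γ = γ' := by
  have hsnd : ∀ (e : ℝ) {t : Set ℝ}, MeasurableSet t → γ (Iic e ×ˢ t) = γ' (Iic e ×ˢ t) := by
    intro e t ht
    have key : (γ.restrict (Prod.fst ⁻¹' Iic e)).map Prod.snd =
        (γ'.restrict (Prod.fst ⁻¹' Iic e)).map Prod.snd := by
      refine Measure.ext_of_Iic _ _ fun z => ?_
      rw [Measure.map_apply measurable_snd measurableSet_Iic,
        Measure.map_apply measurable_snd measurableSet_Iic,
        Measure.restrict_apply (measurable_snd measurableSet_Iic),
        Measure.restrict_apply (measurable_snd measurableSet_Iic), inter_comm]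
      exact h e z
    have := congrArg (fun μ => μ t) key
    simp only [Measure.map_apply measurable_snd ht,
      Measure.restrict_apply (measurable_snd ht)] at this
    rwa [inter_comm] at this
  refine Measure.ext_prod fun {s t} hs ht => ?_
  have key : (γ.restrict (Prod.snd ⁻¹' t)).map Prod.fst =
      (γ'.restrict (Prod.snd ⁻¹' t)).map Prod.fst := by
    refine Measure.ext_of_Iic _ _ fun e => ?_
    rw [Measure.map_apply measurable_fst measurableSet_Iic,
      Measure.map_apply measurable_fst measurableSet_Iic,
      Measure.restrict_apply (measurable_fst measurableSet_Iic),
      Measure.restrict_apply (measurable_fst measurableSet_Iic)]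
    exact hsnd e ht
  have := congrArg (fun μ => μ s) key
  simp only [Measure.map_apply measurable_fst hs,
    Measure.restrict_apply (measurable_fst hs)] at this
  exact this

/-- First-order condition at an interior maximizer. -/
theorem deriv_eq_of_isMaxOn {s : Set ℝ} {W f p : ℝ → ℝ} {z : ℝ} (hz : z ∈ interior s)
    (hW : DifferentiableAt ℝ W z) (hf : DifferentiableAt ℝ f z) (hp : DifferentiableAt ℝ p z)
    (hmax : IsMaxOn (fun w => W w + f w - p w) s z) :
    deriv W z = deriv p z - deriv f z := by
  have h0 := (hmax.isLocalMax (mem_interior_iff_mem_nhds.mp hz)).hasDerivAt_eq_zero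
    ((hW.hasDerivAt.add hf.hasDerivAt).sub hp.hasDerivAt)
  linarith

/-- single-attribute identification, Heckman–Matzkin–Nesheim.
With scalar quality `z ∈ [a,b]`, scalar unobserved taste `ε`, a twice continuously
differentiable surplus `ζ` satisfying the Spence–Mirlees single-crossing condition
`∂²ζ/∂ε∂z > 0`, and a twice continuously differentiable price on the interior of `[a,b]`,
any two twice continuously differentiable utilities compatible with the same single-market
data have `μz`-almost everywhere equal marginal utilities. -/
theorem stmt_0
    (a b : ℝ) (hab : a < b)
    (ζ : ℝ → ℝ → ℝ)
    (hζ : ContDiff ℝ 2 (fun q : ℝ × ℝ => ζ q.1 q.2))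
    (hSC : ∀ ε z : ℝ, 0 < deriv (fun ε' => deriv (fun w => ζ ε' w) z) ε)
    (price : ℝ → ℝ)
    (hprice : ContDiffOn ℝ 2 price (interior (Set.Icc a b)))
    (με μz : Measure ℝ) [IsProbabilityMeasure με] [IsProbabilityMeasure μz]
    (Ubar₁ Ubar₂ : ℝ → ℝ)
    (hUbar₁ : ContDiffOn ℝ 2 Ubar₁ (Set.Icc a b))
    (hUbar₂ : ContDiffOn ℝ 2 Ubar₂ (Set.Icc a b))
    (h₁ : Compatible1D a b ζ price με μz Ubar₁)
    (h₂ : Compatible1D a b ζ price με μz Ubar₂) :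
    ∀ᵐ z ∂μz, deriv Ubar₁ z = deriv Ubar₂ z := by
  have hζz : ∀ ε, Differentiable ℝ (ζ ε) := fun ε =>
    (hζ.differentiable (by norm_num)).comp
      ((differentiable_const ε).prodMk differentiable_id)
  have hmono : ∀ W : ℝ → ℝ,
      ∀ q ∈ {q : ℝ × ℝ | q.2 ∈ interior (Icc a b) ∧
        IsMaxOn (fun z' => W z' + ζ q.1 z' - price z') (Icc a b) q.2},
      ∀ r ∈ {q : ℝ × ℝ | q.2 ∈ interior (Icc a b) ∧
        IsMaxOn (fun z' => W z' + ζ q.1 z' - price z') (Icc a b) q.2},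
      q.2 < r.2 → q.1 ≤ r.1 := by
    rintro W q ⟨hqi, hq⟩ r ⟨hri, hr⟩ hlt
    by_contra! he
    have hinc := sub_lt_sub_of_cross_deriv_pos hζz hSC he hlt
    have hqr := isMaxOn_iff.mp hq r.2 (interior_subset hri)
    have hrq := isMaxOn_iff.mp hr q.2 (interior_subset hqi)
    linarith
  obtain ⟨-, γ₁, hγ₁, hfst₁, hsnd₁, hopt₁⟩ := h₁
  obtain ⟨-, γ₂, hγ₂, hfst₂, hsnd₂, hopt₂⟩ := h₂
  have hγ : γ₁ = γ₂ := measure_ext_of_Iic_prod_Iic fun e z => by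
    rw [measure_Iic_prod_Iic_of_ae_monotone hopt₁ (hmono Ubar₁),
      measure_Iic_prod_Iic_of_ae_monotone hopt₂ (hmono Ubar₂), hfst₁, hfst₂, hsnd₁, hsnd₂]
  subst hγ
  rw [← hsnd₁, ae_map_iff measurable_snd.aemeasurable
    (measurableSet_eq_fun (measurable_deriv Ubar₁) (measurable_deriv Ubar₂))]
  filter_upwards [hopt₁, hopt₂] with q ⟨hi, hm₁⟩ ⟨_, hm₂⟩
  have hnhds : Icc a b ∈ nhds q.2 := mem_interior_iff_mem_nhds.mp hi
  have hp : DifferentiableAt ℝ price q.2 :=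
    (hprice.contDiffAt (isOpen_interior.mem_nhds hi)).differentiableAt (by norm_num)
  rw [deriv_eq_of_isMaxOn hi ((hUbar₁.contDiffAt hnhds).differentiableAt (by norm_num))
      (hζz q.1 q.2) hp hm₁,
    deriv_eq_of_isMaxOn hi ((hUbar₂.contDiffAt hnhds).differentiableAt (by norm_num))
      (hζz q.1 q.2) hp hm₂]
end

section
/- Suppose ζ(ε,z) = ε·z, the consumer-side equilibrium condition holds with coupling γ, and the potential V(z) = p(z) − Ū(z) is convex and lower semicontinuous on Z. Then (i) V attains the minimum of W ↦ ∫_Z W dμ_z + ∫_{ℝ^d} W* dμ_ε over all lower semicontinuous convex functions W : Z → ℝ, where W*(ε) := sup_{z∈Z}(ε·z − W(z)) is the convex (Legendre–Fenchel) conjugate; and (ii) every lower semicontinuous convex minimizer W satisfies W(z) + W*(ε) = ε·z for γ-almost every (ε,z). -/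
open MeasureTheory Set
open scoped RealInnerProductSpace

/-- Convex (Legendre–Fenchel) conjugate of `W : Z → ℝ` relative to the quality space `Z`:
`W*(ε) = sup_{z ∈ Z} (⟪ε,z⟫ - W z)`. -/
noncomputable def legConj {d : ℕ} (Z : Set (EuclideanSpace ℝ (Fin d)))
    (W : EuclideanSpace ℝ (Fin d) → ℝ) (ε : EuclideanSpace ℝ (Fin d)) : ℝ :=
  sSup ((fun z => ⟪ε, z⟫ - W z) '' Z)

/-- **Fenchel–Young inequality** for a lower semicontinuous function on a compact set. -/
theorem inner_le_add_legConj {d : ℕ} {Z : Set (EuclideanSpace ℝ (Fin d))} (hZ : IsCompact Z)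
    {W : EuclideanSpace ℝ (Fin d) → ℝ} (hW : LowerSemicontinuousOn W Z)
    (ε : EuclideanSpace ℝ (Fin d)) {z : EuclideanSpace ℝ (Fin d)} (hz : z ∈ Z) :
    ⟪ε, z⟫ ≤ W z + legConj Z W ε := by
  obtain ⟨m, hm⟩ := hW.bddBelow_of_isCompact hZ
  have hc : ContinuousOn (fun z => ⟪ε, z⟫) Z := by fun_prop
  obtain ⟨M, hM⟩ := hZ.bddAbove_image hc
  have hbdd : BddAbove ((fun z => ⟪ε, z⟫ - W z) '' Z) := by
    refine ⟨M - m, ?_⟩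
    rintro _ ⟨x, hx, rfl⟩
    exact sub_le_sub (hM (mem_image_of_mem _ hx)) (hm (mem_image_of_mem _ hx))
  have : ⟪ε, z⟫ - W z ≤ legConj Z W ε := le_csSup hbdd (mem_image_of_mem _ hz)
  linarith

/-- The conjugate is attained at any maximizer. -/
theorem add_legConj_eq_inner {d : ℕ} {Z : Set (EuclideanSpace ℝ (Fin d))}
    {W : EuclideanSpace ℝ (Fin d) → ℝ} {ε z : EuclideanSpace ℝ (Fin d)} (hz : z ∈ Z)
    (hmax : IsMaxOn (fun z' => ⟪ε, z'⟫ - W z') Z z) :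
    W z + legConj Z W ε = ⟪ε, z⟫ := by
  have h : IsGreatest ((fun z => ⟪ε, z⟫ - W z) '' Z) (⟪ε, z⟫ - W z) :=
    ⟨mem_image_of_mem _ hz, by rintro _ ⟨x, hx, rfl⟩; exact hmax hx⟩
  rw [legConj, h.csSup_eq]
  ring

/-- The integral of a separable sum against a coupling is the sum of the marginal integrals. -/
theorem integrable_and_integral_add_of_coupling {α β : Type*} [MeasurableSpace α]
    [MeasurableSpace β] {γ : Measure (α × β)} {f : α → ℝ} {g : β → ℝ}
    (hf : Integrable f (γ.map Prod.fst)) (hg : Integrable g (γ.map Prod.snd)) :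
    Integrable (fun q : α × β => g q.2 + f q.1) γ ∧
      ∫ q, (g q.2 + f q.1) ∂γ = ∫ y, g y ∂(γ.map Prod.snd) + ∫ x, f x ∂(γ.map Prod.fst) := by
  have hf' : Integrable (fun q : α × β => f q.1) γ := hf.comp_measurable measurable_fst
  have hg' : Integrable (fun q : α × β => g q.2) γ := hg.comp_measurable measurable_snd
  refine ⟨hg'.add hf', ?_⟩
  rw [integral_add hg' hf', integral_map measurable_fst.aemeasurable hf.aestronglyMeasurable,
    integral_map measurable_snd.aemeasurable hg.aestronglyMeasurable]

/-- dual characterization of the potential, linear-in-taste surplus.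
If the consumer-side equilibrium condition holds with coupling `γ` for `ζ(ε,z) = ε·z` and the
potential `V = price - Ubar` is convex and lower semicontinuous on `Z`, then (i) `V` minimizes
`W ↦ ∫ W dμz + ∫ W* dμε` over lower semicontinuous convex (integrable) `W`, and (ii) any
lower semicontinuous convex minimizer `W` satisfies `W z + W* ε = ⟪ε,z⟫` for `γ`-a.e. `(ε,z)`. -/
theorem stmt_2 {d : ℕ} (Z : Set (EuclideanSpace ℝ (Fin d)))
    (hZc : IsCompact Z) (hZi : (interior Z).Nonempty)
    (price Ubar V : EuclideanSpace ℝ (Fin d) → ℝ)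
    (hVdef : V = fun z => price z - Ubar z)
    (με μz : Measure (EuclideanSpace ℝ (Fin d)))
    [IsProbabilityMeasure με] [IsProbabilityMeasure μz]
    (γ : Measure (EuclideanSpace ℝ (Fin d) × EuclideanSpace ℝ (Fin d)))
    (hγ : IsProbabilityMeasure γ)
    (hγ1 : γ.map Prod.fst = με) (hγ2 : γ.map Prod.snd = μz)
    (heqm : ∀ᵐ q ∂γ, q.2 ∈ interior Z ∧
      IsMaxOn (fun z' => ⟪q.1, z'⟫ - V z') Z q.2)
    (hfin : ∀ ε : EuclideanSpace ℝ (Fin d),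
      BddAbove ((fun z' => ⟪ε, z'⟫ - V z') '' Z))
    (hVconv : ConvexOn ℝ Z V) (hVlsc : LowerSemicontinuousOn V Z)
    (hVint : Integrable V μz) (hVcint : Integrable (legConj Z V) με) :
    (∀ W : EuclideanSpace ℝ (Fin d) → ℝ,
        LowerSemicontinuousOn W Z → ConvexOn ℝ Z W →
        Integrable W μz → Integrable (legConj Z W) με →
        ∫ z, V z ∂μz + ∫ ε, legConj Z V ε ∂με
          ≤ ∫ z, W z ∂μz + ∫ ε, legConj Z W ε ∂με) ∧
    (∀ W : EuclideanSpace ℝ (Fin d) → ℝ,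
        LowerSemicontinuousOn W Z → ConvexOn ℝ Z W →
        Integrable W μz → Integrable (legConj Z W) με →
        ∫ z, W z ∂μz + ∫ ε, legConj Z W ε ∂με
          = ∫ z, V z ∂μz + ∫ ε, legConj Z V ε ∂με →
        ∀ᵐ q ∂γ, W q.2 + legConj Z W q.1 = ⟪q.1, q.2⟫) := by
  subst hγ1 hγ2
  have hV : ∀ᵐ q ∂γ, V q.2 + legConj Z V q.1 = ⟪q.1, q.2⟫ :=
    heqm.mono fun q hq => add_legConj_eq_inner (interior_subset hq.1) hq.2
  have hle : ∀ W : EuclideanSpace ℝ (Fin d) → ℝ, LowerSemicontinuousOn W Z →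
      (fun q => V q.2 + legConj Z V q.1) ≤ᵐ[γ] fun q => W q.2 + legConj Z W q.1 := by
    intro W hW
    filter_upwards [heqm, hV] with q hq hVq
    rw [hVq]
    exact inner_le_add_legConj hZc hW q.1 (interior_subset hq.1)
  obtain ⟨hVi, hVe⟩ := integrable_and_integral_add_of_coupling hVcint hVint
  refine ⟨fun W hW _ hWi hWc => ?_, fun W hW _ hWi hWc heq => ?_⟩
  · obtain ⟨hi, he⟩ := integrable_and_integral_add_of_coupling hWc hWi
    rw [← hVe, ← he]
    exact integral_mono_ae hVi hi (hle W hW)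
  · obtain ⟨hi, he⟩ := integrable_and_integral_add_of_coupling hWc hWi
    rw [← hVe, ← he] at heq
    filter_upwards [(integral_eq_iff_of_ae_le hVi hi (hle W hW)).1 heq.symm, hV] with q hq hVq
    exact hq.symm.trans hVq
end

section
/- Suppose the two-sided hedonic equilibrium condition holds with ζ(ε,z) = ε·z, that Ū, ζ and C are twice continuously differentiable, that there is a constant M₁ with D²_{zz}(U(ε,z) − C(ỹ,z)) ≤ M₁·Id as quadratic forms for all (ε,z,ỹ), and that the taste distribution μ_ε is absolutely continuous with respect to Lebesgue measure on ℝ^d. Then the endogenous distribution μ_z of qualities traded at equilibrium is absolutely continuous with respect to Lebesgue measure on ℝ^d. -/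
open MeasureTheory Set
open scoped RealInnerProductSpace

/-- `ε` is a global subgradient of `φ` at `z` relative to `Z`, and the affine function it defines
approximates `φ` from below up to the quadratic error `K * ‖w - z‖ ^ 2`. -/
def IsQuadraticSubgradient {E : Type*} [NormedAddCommGroup E] [InnerProductSpace ℝ E]
    (φ : E → ℝ) (Z : Set E) (K : ℝ) (ε z : E) : Prop :=
  ∀ w ∈ Z, ⟪ε, w - z⟫ ≤ φ w - φ z ∧ φ w - φ z ≤ ⟪ε, w - z⟫ + K * ‖w - z‖ ^ 2

namespace IsQuadraticSubgradient

section InnerProduct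

variable {E : Type*} [NormedAddCommGroup E] [InnerProductSpace ℝ E]
  {φ : E → ℝ} {Z : Set E} {K : ℝ}

theorem norm_sub_le (hK : 0 ≤ K) {ε₁ ε₂ z₁ z₂ : E}
    (h₁ : IsQuadraticSubgradient φ Z K ε₁ z₁) (h₂ : IsQuadraticSubgradient φ Z K ε₂ z₂)
    {t : ℝ} (ht : 0 < t) (hball : Metric.closedBall z₁ t ⊆ Z) (hz : ‖z₁ - z₂‖ ≤ t) :
    ‖ε₁ - ε₂‖ ≤ 4 * K * t := by
  rcases eq_or_ne (ε₁ - ε₂) 0 with h0 | h0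
  · rw [h0, norm_zero]; positivity
  have hn : 0 < ‖ε₁ - ε₂‖ := norm_pos_iff.2 h0
  set v : E := (t / ‖ε₁ - ε₂‖) • (ε₁ - ε₂) with hv
  have hvn : ‖v‖ = t := by
    rw [hv, norm_smul, Real.norm_of_nonneg (by positivity)]
    field_simp
  have hmem : z₁ + v ∈ Z := hball (by simp [Metric.mem_closedBall, dist_eq_norm, hvn])
  have hz₁ : z₁ ∈ Z := hball (Metric.mem_closedBall_self ht.le)
  have e₁ := (h₁ _ hmem).1
  have e₂ := (h₂ _ hmem).2
  have e₃ := (h₂ _ hz₁).1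
  have hinner : ⟪ε₁ - ε₂, v⟫ = t * ‖ε₁ - ε₂‖ := by
    rw [hv, inner_smul_right, real_inner_self_eq_norm_sq]
    field_simp
  have hsum : ‖z₁ + v - z₂‖ ≤ 2 * t := by
    calc ‖z₁ + v - z₂‖ = ‖(z₁ - z₂) + v‖ := by congr 1; abel
      _ ≤ ‖z₁ - z₂‖ + ‖v‖ := norm_add_le _ _
      _ ≤ 2 * t := by linarith
  have hsq : K * ‖z₁ + v - z₂‖ ^ 2 ≤ K * (2 * t) ^ 2 := by gcongr
  have hsplit : ⟪ε₂, z₁ + v - z₂⟫ = ⟪ε₂, z₁ - z₂⟫ + ⟪ε₂, v⟫ := by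
    rw [← inner_add_right]; congr 1; abel
  rw [inner_sub_left] at hinner
  rw [add_sub_cancel_left] at e₁
  have hfin : t * ‖ε₁ - ε₂‖ ≤ t * (4 * K * t) := by nlinarith
  exact le_of_mul_le_mul_left hfin ht

theorem unique (hK : 0 ≤ K) {ε₁ ε₂ z : E} (hz : z ∈ interior Z)
    (h₁ : IsQuadraticSubgradient φ Z K ε₁ z) (h₂ : IsQuadraticSubgradient φ Z K ε₂ z) :
    ε₁ = ε₂ := by
  obtain ⟨r, hr, hrZ⟩ := Metric.nhds_basis_closedBall.mem_iff.1 (mem_interior_iff_mem_nhds.1 hz)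
  by_contra hne
  have hn : 0 < ‖ε₁ - ε₂‖ := norm_pos_iff.2 (sub_ne_zero.2 hne)
  have ht : 0 < min r (‖ε₁ - ε₂‖ / (4 * K + 1)) := lt_min hr (by positivity)
  have h := norm_sub_le hK h₁ h₂ ht
    ((Metric.closedBall_subset_closedBall (min_le_left _ _)).trans hrZ) (by simpa using ht.le)
  have hle := min_le_right r (‖ε₁ - ε₂‖ / (4 * K + 1))
  rw [le_div_iff₀ (by positivity)] at hle
  linarith

theorem exists_lipschitzOnWith (hK : 0 ≤ K) {G : E → E} {S : Set E}
    (hG : ∀ z ∈ S, IsQuadraticSubgradient φ Z K (G z) z) {z₀ : E} (hz₀ : z₀ ∈ interior Z) :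
    ∃ U ∈ nhds z₀, LipschitzOnWith (4 * K).toNNReal G (S ∩ U) := by
  obtain ⟨r, hr, hrZ⟩ := Metric.mem_nhds_iff.1 (mem_interior_iff_mem_nhds.1 hz₀)
  refine ⟨Metric.ball z₀ (r / 3), Metric.ball_mem_nhds _ (by positivity), ?_⟩
  refine LipschitzOnWith.of_dist_le_mul fun z₁ hz₁ z₂ hz₂ => ?_
  rw [Real.coe_toNNReal _ (by positivity)]
  rcases eq_or_ne z₁ z₂ with rfl | hne
  · simp
  have h₁ := Metric.mem_ball.1 hz₁.2
  have h₂ := Metric.mem_ball.1 hz₂.2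
  rw [dist_eq_norm (G z₁)]
  refine norm_sub_le hK (hG z₁ hz₁.1) (hG z₂ hz₂.1) (dist_pos.2 hne)
    (fun w hw => hrZ ?_) (dist_eq_norm z₁ z₂).ge
  rw [Metric.mem_closedBall] at hw
  rw [Metric.mem_ball]
  linarith [dist_triangle w z₁ z₀, dist_triangle_right z₁ z₂ z₀]

end InnerProduct

theorem addHaar_image_eq_zero {E : Type*} [NormedAddCommGroup E] [InnerProductSpace ℝ E]
    [FiniteDimensional ℝ E] [MeasurableSpace E] [BorelSpace E] (μ : Measure E)
    [μ.IsAddHaarMeasure] {φ : E → ℝ} {Z : Set E} {K : ℝ} (hK : 0 ≤ K) {G : E → E} {S : Set E}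
    (hSZ : S ⊆ interior Z) (hG : ∀ z ∈ S, IsQuadraticSubgradient φ Z K (G z) z) (hS : μ S = 0) :
    μ (G '' S) = 0 := by
  have hHS : Measure.hausdorffMeasure (Module.finrank ℝ E) S = 0 :=
    Measure.absolutelyContinuous_isAddHaarMeasure _ μ hS
  refine Measure.absolutelyContinuous_isAddHaarMeasure μ
    (Measure.hausdorffMeasure (Module.finrank ℝ E)) ?_
  choose! U hU hLip using fun z (hz : z ∈ S) => exists_lipschitzOnWith hK hG (hSZ hz)
  obtain ⟨T, hTS, hTc, hcov⟩ := TopologicalSpace.countable_cover_nhdsWithin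
    (fun z hz => mem_nhdsWithin_of_mem_nhds (hU z hz))
  have hsub : G '' S ⊆ ⋃ z ∈ T, G '' (S ∩ U z) := by
    rintro _ ⟨z, hz, rfl⟩
    obtain ⟨x, hx, hzx⟩ := mem_iUnion₂.1 (hcov hz)
    exact mem_iUnion₂.2 ⟨x, hx, mem_image_of_mem G ⟨hz, hzx⟩⟩
  refine measure_mono_null hsub ((measure_biUnion_null_iff hTc).2 fun z hz => ?_)
  refine le_antisymm (((hLip z (hTS hz)).hausdorffMeasure_image_le (by positivity)).trans ?_)
    zero_le
  rw [measure_mono_null inter_subset_left hHS, mul_zero]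

end IsQuadraticSubgradient

theorem ContDiff.exists_norm_sub_sub_fderiv_le {E F : Type*} [NormedAddCommGroup E]
    [NormedSpace ℝ E] [NormedAddCommGroup F] [NormedSpace ℝ F] {f : E → F} (hf : ContDiff ℝ 2 f)
    {s : Set E} (hs : IsCompact s) (hconv : Convex ℝ s) :
    ∃ K : ℝ, 0 ≤ K ∧ ∀ x ∈ s, ∀ y ∈ s,
      ‖f y - f x - fderiv ℝ f x (y - x)‖ ≤ K * ‖y - x‖ ^ 2 := by
  have hdf : ContDiff ℝ 1 (fderiv ℝ f) := hf.fderiv_right (by norm_num)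
  obtain ⟨K, hK⟩ := hdf.contDiffOn.exists_lipschitzOnWith one_ne_zero hconv hs
  refine ⟨K, K.2, fun x hx y hy => ?_⟩
  have hseg : segment ℝ x y ⊆ s := hconv.segment_subset hx hy
  have h := (convex_segment (𝕜 := ℝ) x y).norm_image_sub_le_of_norm_fderiv_le'
    (fun w _ => hf.differentiable two_ne_zero w) (C := K * ‖y - x‖) (φ := fderiv ℝ f x)
    (fun w hw => ?_) (left_mem_segment ℝ x y) (right_mem_segment ℝ x y)
  · calc _ ≤ _ := h
      _ = _ := by ring
  · refine (hK.norm_sub_le (hseg hw) hx).trans ?_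
    gcongr
    obtain ⟨a, b, ha, hb, hab, rfl⟩ := hw
    have : a • x + b • y - x = b • (y - x) := by
      rw [← sub_eq_iff_eq_add'.2 hab.symm]; module
    rw [this, norm_smul, Real.norm_of_nonneg hb]
    exact mul_le_of_le_one_left (norm_nonneg _) (by linarith)

/-- If `f y - ⟪ε, ·⟫` has an interior minimum at `z`, then `f y` stays within a quadratic error of
its tangent `⟪ε, ·⟫` at `z`, uniformly in the parameter `y` and in `z`. -/
theorem exists_sub_le_inner_add_sq {E P : Type*} [NormedAddCommGroup E] [InnerProductSpace ℝ E]
    [FiniteDimensional ℝ E] [NormedAddCommGroup P] [NormedSpace ℝ P] [FiniteDimensional ℝ P]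
    {f : P → E → ℝ} (hf : ContDiff ℝ 2 (fun q : P × E => f q.1 q.2)) {Y : Set P} {Z : Set E}
    (hY : IsCompact Y) (hZ : IsCompact Z) :
    ∃ K : ℝ, 0 ≤ K ∧ ∀ ε, ∀ y ∈ Y, ∀ z ∈ interior Z,
      (∀ w ∈ Z, ⟪ε, w - z⟫ ≤ f y w - f y z) →
        ∀ w ∈ Z, f y w - f y z ≤ ⟪ε, w - z⟫ + K * ‖w - z‖ ^ 2 := by
  obtain ⟨R, hR⟩ := (hY.prod hZ).isBounded.subset_closedBall (0 : P × E)
  obtain ⟨K, hK0, hK⟩ := hf.exists_norm_sub_sub_fderiv_le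
    (isCompact_closedBall (0 : P × E) R) (convex_closedBall _ _)
  refine ⟨K, hK0, fun ε y hy z hz hmin w hw => ?_⟩
  have hdiff : HasFDerivAt (f y) ((fderiv ℝ (fun q : P × E => f q.1 q.2) (y, z)).comp
      (ContinuousLinearMap.inr ℝ P E)) z :=
    (hf.differentiable two_ne_zero (y, z)).hasFDerivAt.comp z (hasFDerivAt_prodMk_right y z)
  have hloc : IsLocalMin (fun x => f y x - ⟪ε, x⟫) z := by
    filter_upwards [mem_interior_iff_mem_nhds.1 hz] with x hx
    have := hmin x hx
    rw [inner_sub_right] at this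
    linarith
  have hzero := hloc.hasFDerivAt_eq_zero (hdiff.sub (innerSL ℝ ε).hasFDerivAt)
  have happ := DFunLike.congr_fun hzero (w - z)
  have h := hK (y, z) (hR ⟨hy, interior_subset hz⟩) (y, w) (hR ⟨hy, hw⟩)
  have hsub : (y, w) - (y, z) = ((0 : P), w - z) := by simp
  rw [hsub, Prod.norm_mk, norm_zero, max_eq_right (norm_nonneg _)] at h
  have h' := (abs_le.1 (by simpa only [Real.norm_eq_abs] using h)).2
  simp at happ
  linarith

/-- absolute continuity of the equilibrium quality distribution,
linear-in-taste case. Under the two-sided hedonic equilibrium condition with surplus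
`ζ(ε,z) = ε·z`, twice continuously differentiable `Ubar` and `C`, a uniform upper bound
`M₁·Id` on the Hessian in `z` of the joint surplus `U(ε,z) - C(y,z)`, and absolutely
continuous taste distribution `με`, the distribution `μz` of traded qualities (the
`z`-marginal of the equilibrium measure `γ`) is absolutely continuous with respect to
Lebesgue measure on `ℝ^d`. -/
theorem stmt_5 {d m : ℕ}
    (Z : Set (EuclideanSpace ℝ (Fin d))) (hZc : IsCompact Z) (hZi : (interior Z).Nonempty)
    (Y : Set (EuclideanSpace ℝ (Fin m))) (hYc : IsCompact Y)
    (Ubar : EuclideanSpace ℝ (Fin d) → ℝ)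
    (C : EuclideanSpace ℝ (Fin m) → EuclideanSpace ℝ (Fin d) → ℝ)
    (price : EuclideanSpace ℝ (Fin d) → ℝ)
    (hU : ContDiff ℝ 2 Ubar)
    (hC : ContDiff ℝ 2 (fun q : EuclideanSpace ℝ (Fin m) × EuclideanSpace ℝ (Fin d) => C q.1 q.2))
    (M₁ : ℝ)
    (hHess : ∀ (ε : EuclideanSpace ℝ (Fin d)) (y : EuclideanSpace ℝ (Fin m))
      (z v : EuclideanSpace ℝ (Fin d)),
      ((fderiv ℝ (fderiv ℝ (fun w => (Ubar w + ⟪ε, w⟫) - C y w)) z) v) v ≤ M₁ * ‖v‖ ^ 2)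
    (με : Measure (EuclideanSpace ℝ (Fin d))) [IsProbabilityMeasure με]
    (μy : Measure (EuclideanSpace ℝ (Fin m))) [IsProbabilityMeasure μy]
    (hac : με ≪ volume) (hμy : ∀ᵐ y ∂μy, y ∈ Y)
    (γ : Measure (EuclideanSpace ℝ (Fin d) × EuclideanSpace ℝ (Fin d) × EuclideanSpace ℝ (Fin m)))
    (hγ : IsProbabilityMeasure γ)
    (hγε : γ.map (fun q => q.1) = με)
    (hγy : γ.map (fun q => q.2.2) = μy)
    (heqm : ∀ᵐ q ∂γ, q.2.1 ∈ interior Z ∧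
      IsMaxOn (fun z' => (Ubar z' + ⟪q.1, z'⟫) - price z') Z q.2.1 ∧
      IsMaxOn (fun z' => price z' - C q.2.2 z') Z q.2.1)
    (hsel : ∃ sel : EuclideanSpace ℝ (Fin d) × EuclideanSpace ℝ (Fin m) → EuclideanSpace ℝ (Fin d),
      Measurable sel ∧ ∀ ε y, sel (ε, y) ∈ Z ∧
        IsMaxOn (fun z => (Ubar z + ⟪ε, z⟫) - C y z) Z (sel (ε, y))) :
    γ.map (fun q => q.2.1) ≪ volume := by
  have hF : ContDiff ℝ 2 (fun q : EuclideanSpace ℝ (Fin m) × EuclideanSpace ℝ (Fin d) =>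
      C q.1 q.2 - Ubar q.2) := hC.sub (hU.comp contDiff_snd)
  obtain ⟨K, hK, hquad⟩ :=
    exists_sub_le_inner_add_sq (f := fun y z => C y z - Ubar z) hF hYc hZc
  set φ : EuclideanSpace ℝ (Fin d) → ℝ := fun z => price z - Ubar z with hφ
  have hY : ∀ᵐ q ∂γ, q.2.2 ∈ Y :=
    ae_of_ae_map (μ := γ) (f := fun q => q.2.2) (p := fun y => y ∈ Y) (by fun_prop) (hγy ▸ hμy)
  have hsub : ∀ᵐ q ∂γ, q.2.1 ∈ interior Z ∧ IsQuadraticSubgradient φ Z K q.1 q.2.1 := by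
    filter_upwards [heqm, hY] with ⟨ε, z, y⟩ ⟨hz, hcons, hprod⟩ hy
    have hlow : ∀ w ∈ Z, ⟪ε, w - z⟫ ≤ φ w - φ z := fun w hw => by
      have := isMaxOn_iff.1 hcons w hw
      simp only [hφ, inner_sub_right] at this ⊢
      linarith
    have hup : ∀ w ∈ Z, φ w - φ z ≤ (C y w - Ubar w) - (C y z - Ubar z) := fun w hw => by
      have := isMaxOn_iff.1 hprod w hw
      simp only [hφ] at this ⊢
      linarith
    exact ⟨hz, fun w hw => ⟨hlow w hw, (hup w hw).trans
      (hquad ε y hy z hz (fun x hx => (hlow x hx).trans (hup x hx)) w hw)⟩⟩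
  let S := {z | z ∈ interior Z ∧ ∃ ε, IsQuadraticSubgradient φ Z K ε z}
  have hS : ∀ z ∈ S, ∃ ε, IsQuadraticSubgradient φ Z K ε z := fun z hz => hz.2
  choose! G hG using hS
  refine Measure.AbsolutelyContinuous.mk fun A hA hA0 => ?_
  have himage : volume (G '' (A ∩ S)) = 0 :=
    IsQuadraticSubgradient.addHaar_image_eq_zero volume hK (fun z hz => hz.2.1)
      (fun z hz => hG z hz.2) (measure_mono_null inter_subset_left hA0)
  have hpre : γ ((fun q => q.1) ⁻¹' (G '' (A ∩ S))) = 0 :=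
    Measure.preimage_null_of_map_null (by fun_prop) (hγε ▸ hac himage)
  rw [Measure.map_apply (by fun_prop) hA]
  refine measure_mono_null_ae ?_ hpre
  filter_upwards [hsub] with q ⟨hz, hq⟩ hqA
  have hqS : q.2.1 ∈ S := ⟨hz, q.1, hq⟩
  exact ⟨q.2.1, ⟨hqA, hqS⟩, (hG _ hqS).unique hK hz hq⟩
end

section
/- Suppose the two-sided hedonic equilibrium condition holds with ζ(ε,z) = ε·z, that Ū, ζ and C are twice continuously differentiable, that there is a constant M₁ with D²_{zz}(U(ε,z) − C(ỹ,z)) ≤ M₁·Id as quadratic forms for all (ε,z,ỹ), and that μ_ε is absolutely continuous with respect to Lebesgue measure with finite second moment. Then, without imposing any convexity restriction on the potential, the marginal utility is nonparametrically identified: if Ū' is any continuously differentiable function on Z compatible with the data (μ_ε, μ_z, p), then ∇Ū'(z) = ∇Ū(z) for μ_z-almost every z. -/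
open MeasureTheory Set
open scoped RealInnerProductSpace

/-- A candidate deterministic utility `W` is *compatible* with the single-market data
`(με, μz, price)` for the bilinear surplus `ζ(ε,z) = ⟪ε,z⟫`: there is a probability
coupling of tastes and traded qualities with marginals `με` and `μz` such that almost
every traded quality lies in the interior of `Z` and maximizes the consumer objective. -/
def CompatibleLin {d : ℕ} (Z : Set (EuclideanSpace ℝ (Fin d)))
    (price : EuclideanSpace ℝ (Fin d) → ℝ)
    (με μz : Measure (EuclideanSpace ℝ (Fin d)))
    (W : EuclideanSpace ℝ (Fin d) → ℝ) : Prop :=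
  ∃ γ : Measure (EuclideanSpace ℝ (Fin d) × EuclideanSpace ℝ (Fin d)),
    IsProbabilityMeasure γ ∧
    γ.map Prod.fst = με ∧ γ.map Prod.snd = μz ∧
    ∀ᵐ q ∂γ, q.2 ∈ interior Z ∧
      IsMaxOn (fun z' => W z' + ⟪q.1, z'⟫ - price z') Z q.2

section Helpers

variable {E : Type*} [NormedAddCommGroup E]

/-- A function squeezed near `x` between two functions that are differentiable at `x` and take the
same value there is differentiable at `x`. -/
theorem DifferentiableAt.of_eventually_le_of_eventually_le [NormedSpace ℝ E] {f g h : E → ℝ}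
    {x : E} (hf : DifferentiableAt ℝ f x) (hh : DifferentiableAt ℝ h x)
    (hfg : ∀ᶠ y in nhds x, f y ≤ g y) (hgh : ∀ᶠ y in nhds x, g y ≤ h y)
    (hfx : f x = g x) (hhx : h x = g x) : DifferentiableAt ℝ g x := by
  have hmin : IsLocalMin (fun y => h y - f y) x := by
    filter_upwards [hfg, hgh] with y h1 h2
    linarith
  have heq : fderiv ℝ h x - fderiv ℝ f x = 0 :=
    hmin.hasFDerivAt_eq_zero (hh.hasFDerivAt.sub hf.hasFDerivAt)
  have hf' := hf.hasFDerivAt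
  have hh' := hh.hasFDerivAt
  rw [sub_eq_zero.1 heq] at hh'
  refine HasFDerivAt.differentiableAt (f' := fderiv ℝ f x) ?_
  rw [hasFDerivAt_iff_isLittleO] at hf' hh' ⊢
  have hsum := hf'.norm_left.add hh'.norm_left
  refine Asymptotics.IsBigO.trans_isLittleO (Asymptotics.IsBigO.of_bound 1 ?_) hsum
  filter_upwards [hfg, hgh] with y h1 h2
  rw [one_mul, Real.norm_eq_abs, Real.norm_eq_abs, Real.norm_eq_abs, Real.norm_eq_abs]
  refine le_trans ?_ (le_abs_self _)
  have h3 := neg_abs_le (f y - f x - (fderiv ℝ f x) (y - x))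
  have h4 := le_abs_self (h y - h x - (fderiv ℝ f x) (y - x))
  have h5 := abs_nonneg (f y - f x - (fderiv ℝ f x) (y - x))
  have h6 := abs_nonneg (h y - h x - (fderiv ℝ f x) (y - x))
  rw [abs_le]
  constructor <;> linarith

/-- On a Polish space, an almost-everywhere property of the image under a continuous map holds
almost everywhere for the image measure, even when the property is not measurable. -/
theorem MeasureTheory.ae_map_of_continuous {X Y : Type*} [TopologicalSpace X] [PolishSpace X]
    [MeasurableSpace X] [BorelSpace X] [TopologicalSpace Y] [T2Space Y] [MeasurableSpace Y]
    [BorelSpace Y] {μ : Measure X} [IsFiniteMeasure μ] {f : X → Y} (hf : Continuous f)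
    {P : Y → Prop} (h : ∀ᵐ x ∂μ, P (f x)) : ∀ᵐ y ∂(μ.map f), P y := by
  set T := (toMeasurable μ {x | ¬ P (f x)})ᶜ with hT
  have hTm : MeasurableSet T := (measurableSet_toMeasurable _ _).compl
  have hT0 : μ Tᶜ = 0 := by
    rw [hT, compl_compl, measure_toMeasurable]
    exact h
  have hTP : ∀ x ∈ T, P (f x) := by
    intro x hx
    by_contra hP
    exact hx (subset_toMeasurable _ _ hP)
  refine le_antisymm (le_of_forall_pos_le_add fun δ hδ => ?_) zero_le
  obtain ⟨K, hKT, hK, hKδ⟩ := hTm.exists_isCompact_sdiff_lt (measure_ne_top μ T) hδ.ne'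
  have hsub : {y | ¬ P y} ⊆ (f '' K)ᶜ := by
    rintro y hy ⟨x, hx, rfl⟩
    exact hy (hTP x (hKT hx))
  calc μ.map f {y | ¬ P y} ≤ μ.map f (f '' K)ᶜ := measure_mono hsub
    _ = μ (f ⁻¹' (f '' K)ᶜ) := by
        rw [Measure.map_apply hf.measurable (hK.image hf).isClosed.measurableSet.compl]
    _ ≤ μ (Tᶜ ∪ T \ K) := by
        refine measure_mono fun x hx => ?_
        by_cases hxT : x ∈ T
        · exact Or.inr ⟨hxT, fun hxK => hx ⟨x, hxK, rfl⟩⟩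
        · exact Or.inl hxT
    _ ≤ μ Tᶜ + μ (T \ K) := measure_union_le _ _
    _ ≤ 0 + δ := by
        rw [hT0]
        gcongr

variable [InnerProductSpace ℝ E]

/-- Maximizers of `W + ⟪ε, ·⟫ - p` satisfy the first-order condition. -/
theorem fderiv_add_inner_eq_of_isMaxOn {Z : Set E} {W p : E → ℝ} {ε z : E}
    (hz : z ∈ interior Z) (hW : DifferentiableAt ℝ W z) (hp : DifferentiableAt ℝ p z)
    (hmax : IsMaxOn (fun z' => W z' + ⟪ε, z'⟫ - p z') Z z) :
    fderiv ℝ W z = fderiv ℝ p z - innerSL ℝ ε := by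
  have h := (hmax.isLocalMax (mem_interior_iff_mem_nhds.1 hz)).hasFDerivAt_eq_zero
    ((hW.hasFDerivAt.add (innerSL ℝ ε).hasFDerivAt).sub hp.hasFDerivAt)
  rw [sub_eq_zero] at h
  rw [← h, add_sub_cancel_right]

variable [SecondCountableTopology E] [MeasurableSpace E] [BorelSpace E]

/-- A bounded second coordinate and an integrable first one make the pairing integrable. -/
theorem integrable_inner_of_bounded_snd {Z : Set E} (hZ : Bornology.IsBounded Z)
    {π : Measure (E × E)} (hmom : Integrable (fun ε => ‖ε‖) (π.map Prod.fst))
    (hπ : ∀ᵐ q ∂π, q.2 ∈ Z) : Integrable (fun q : E × E => ⟪q.1, q.2⟫) π := by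
  obtain ⟨R, hR⟩ := hZ.exists_norm_le
  have h1 : Integrable (fun q : E × E => ‖q.1‖) π := hmom.comp_measurable measurable_fst
  refine (h1.mul_const R).mono' (Continuous.aestronglyMeasurable (by fun_prop)) ?_
  filter_upwards [hπ] with q hq
  refine (norm_inner_le_norm _ _).trans ?_
  gcongr
  exact hR _ hq

/-- The slack of a pair of potentials integrates, against any coupling of the two marginals, to
the difference of the potentials' integrals and the pairing. -/
theorem integral_slack {Z : Set E} (hZ : Bornology.IsBounded Z) {a V : E → ℝ}
    {π : Measure (E × E)} (hmom : Integrable (fun ε => ‖ε‖) (π.map Prod.fst))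
    (hπ : ∀ᵐ q ∂π, q.2 ∈ Z) (ha : Integrable a (π.map Prod.fst))
    (hV : Integrable V (π.map Prod.snd)) :
    Integrable (fun q : E × E => a q.1 + V q.2 - ⟪q.1, q.2⟫) π ∧
      ∫ q, (a q.1 + V q.2 - ⟪q.1, q.2⟫) ∂π =
        ∫ ε, a ε ∂(π.map Prod.fst) + ∫ z, V z ∂(π.map Prod.snd) - ∫ q, ⟪q.1, q.2⟫ ∂π := by
  have h1 : Integrable (fun q : E × E => a q.1) π := ha.comp_measurable measurable_fst
  have h2 : Integrable (fun q : E × E => V q.2) π := hV.comp_measurable measurable_snd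
  have h3 := integrable_inner_of_bounded_snd hZ hmom hπ
  refine ⟨(h1.add h2).sub h3, ?_⟩
  rw [integral_map measurable_fst.aemeasurable ha.aestronglyMeasurable,
    integral_map measurable_snd.aemeasurable hV.aestronglyMeasurable, ← integral_add h1 h2]
  exact integral_sub (h1.add h2) h3

variable [CompleteSpace E]

/-- A coupling concentrated on the contact set of `V` and its conjugate over `Z` makes `V`
integrable, and the conjugate is an integrable function. -/
theorem exists_integrable_conjugate {Z : Set E} (hZ : Bornology.IsBounded Z) {V : E → ℝ} {K : ℝ}
    (hV : ∀ z ∈ Z, |V z| ≤ K) {π : Measure (E × E)} [IsProbabilityMeasure π]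
    (hmom : Integrable (fun ε => ‖ε‖) (π.map Prod.fst))
    (hπ : ∀ᵐ q ∂π, q.2 ∈ Z ∧ IsMaxOn (fun z => ⟪q.1, z⟫ - V z) Z q.2) :
    ∃ a : E → ℝ, Integrable a (π.map Prod.fst) ∧ Integrable V (π.map Prod.snd) ∧
      (∀ ε, ∀ z ∈ Z, ⟪ε, z⟫ - V z ≤ a ε) ∧ ∀ᵐ q ∂π, ⟪q.1, q.2⟫ - V q.2 = a q.1 := by
  have : IsProbabilityMeasure (π.map Prod.fst) :=
    Measure.isProbabilityMeasure_map measurable_fst.aemeasurable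
  have : IsProbabilityMeasure (π.map Prod.snd) :=
    Measure.isProbabilityMeasure_map measurable_snd.aemeasurable
  obtain ⟨q₀, hq₀⟩ := hπ.exists
  have : Nonempty Z := ⟨⟨q₀.2, hq₀.1⟩⟩
  obtain ⟨R, hR⟩ := hZ.exists_norm_le
  have hle : ∀ ε, ∀ z ∈ Z, |⟪ε, z⟫ - V z| ≤ ‖ε‖ * R + K := fun ε z hz =>
    calc |⟪ε, z⟫ - V z| ≤ |⟪ε, z⟫| + |V z| := abs_sub _ _
      _ ≤ ‖ε‖ * ‖z‖ + K := add_le_add (abs_real_inner_le_norm ε z) (hV z hz)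
      _ ≤ ‖ε‖ * R + K := by gcongr; exact hR z hz
  have hbdd : ∀ ε, BddAbove (range fun z : Z => ⟪ε, (z : E)⟫ - V z) := by
    rintro ε
    refine ⟨‖ε‖ * R + K, ?_⟩
    rintro _ ⟨z, rfl⟩
    exact (le_abs_self _).trans (hle ε z z.2)
  set a : E → ℝ := fun ε => ⨆ z : Z, (⟪ε, (z : E)⟫ - V z) with ha
  have hale : ∀ ε, ∀ z ∈ Z, ⟪ε, z⟫ - V z ≤ a ε := fun ε z hz => le_ciSup (hbdd ε) ⟨z, hz⟩
  have haeq : ∀ᵐ q ∂π, ⟪q.1, q.2⟫ - V q.2 = a q.1 := by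
    filter_upwards [hπ] with q hq
    exact le_antisymm (hale _ _ hq.1) (ciSup_le fun z => hq.2 z.2)
  have hlip : LipschitzWith (Real.toNNReal R) a := by
    refine LipschitzWith.of_le_add_mul' R fun ε ε' => ciSup_le fun z => ?_
    have h1 := hale ε' z z.2
    have h2 : ⟪ε, (z : E)⟫ - ⟪ε', (z : E)⟫ ≤ R * dist ε ε' := by
      rw [← inner_sub_left, dist_eq_norm, mul_comm]
      refine (real_inner_le_norm _ _).trans ?_
      gcongr
      exact hR z z.2
    linarith
  have haint : Integrable a (π.map Prod.fst) := by
    refine ((hmom.mul_const R).add (integrable_const K)).mono'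
      hlip.continuous.aestronglyMeasurable (ae_of_all _ fun ε => ?_)
    have h1 := hale ε q₀.2 hq₀.1
    have h2 := neg_le_of_abs_le (hle ε q₀.2 hq₀.1)
    simp only [Pi.add_apply]
    rw [Real.norm_eq_abs, abs_le]
    exact ⟨by linarith, ciSup_le fun z => (le_abs_self _).trans (hle ε z z.2)⟩
  set W : E → EReal := fun z => ⨆ ε : E, ((⟪ε, z⟫ - a ε : ℝ) : EReal) with hW
  have hWm : Measurable W := by
    refine (lowerSemicontinuous_iSup fun ε => Continuous.lowerSemicontinuous ?_).measurable
    exact continuous_coe_real_ereal.comp (by fun_prop)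
  have hWV : ∀ᵐ z ∂(π.map Prod.snd), z ∈ Z ∧ (W z).toReal = V z := by
    refine ae_map_of_continuous (μ := π) continuous_snd ?_
    filter_upwards [hπ, haeq] with q hq hqa
    refine ⟨hq.1, ?_⟩
    have : W q.2 = (V q.2 : ℝ) := by
      refine le_antisymm (iSup_le fun ε => ?_) (le_iSup_of_le q.1 ?_)
      · exact EReal.coe_le_coe_iff.2 (by linarith [hale ε q.2 hq.1])
      · exact EReal.coe_le_coe_iff.2 (by linarith)
    rw [this, EReal.toReal_coe]
  have hVm : AEStronglyMeasurable V (π.map Prod.snd) :=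
    hWm.ereal_toReal.aestronglyMeasurable.congr (hWV.mono fun z hz => hz.2)
  exact ⟨a, haint, (integrable_const K).mono' hVm (hWV.mono fun z hz => hV z hz.1), hale, haeq⟩

/-- A coupling concentrated on maximizers maximizes the expected pairing among all couplings with
the same marginals; any other coupling attaining the same value is concentrated on maximizers. -/
theorem integral_inner_le_and_ae_isMaxOn {Z : Set E} (hZ : Bornology.IsBounded Z) {V : E → ℝ}
    {K : ℝ} (hV : ∀ z ∈ Z, |V z| ≤ K) {π π' : Measure (E × E)} [IsProbabilityMeasure π]
    (hmom : Integrable (fun ε => ‖ε‖) (π.map Prod.fst))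
    (hfst : π'.map Prod.fst = π.map Prod.fst) (hsnd : π'.map Prod.snd = π.map Prod.snd)
    (hπ : ∀ᵐ q ∂π, q.2 ∈ Z ∧ IsMaxOn (fun z => ⟪q.1, z⟫ - V z) Z q.2)
    (hπ' : ∀ᵐ q ∂π', q.2 ∈ Z) :
    ∫ q, ⟪q.1, q.2⟫ ∂π' ≤ ∫ q, ⟪q.1, q.2⟫ ∂π ∧
      (∫ q, ⟪q.1, q.2⟫ ∂π ≤ ∫ q, ⟪q.1, q.2⟫ ∂π' →
        ∀ᵐ q ∂π', IsMaxOn (fun z => ⟪q.1, z⟫ - V z) Z q.2) := by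
  obtain ⟨a, haint, hVint, hale, haeq⟩ := exists_integrable_conjugate hZ hV hmom hπ
  have hs := (integral_slack hZ hmom (hπ.mono fun q hq => hq.1) haint hVint).2
  have hs0 : ∫ q, (a q.1 + V q.2 - ⟪q.1, q.2⟫) ∂π = 0 :=
    integral_eq_zero_of_ae (haeq.mono fun q hq => by simp only [Pi.zero_apply]; linarith)
  obtain ⟨hi', hs'⟩ := integral_slack (π := π') hZ (hfst ▸ hmom) hπ' (hfst ▸ haint)
    (hsnd ▸ hVint)
  rw [hfst, hsnd] at hs'
  have hnonneg : 0 ≤ᵐ[π'] fun q => a q.1 + V q.2 - ⟪q.1, q.2⟫ :=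
    hπ'.mono fun q hq => by
      have := hale q.1 q.2 hq
      simp only [Pi.zero_apply]
      linarith
  have hpos := integral_nonneg_of_ae hnonneg
  refine ⟨by linarith, fun hge => ?_⟩
  have hzero := (integral_eq_zero_iff_of_nonneg_ae hnonneg hi').1 (by linarith)
  filter_upwards [hzero] with q hq z hz
  have := hale q.1 z hz
  simp only [Pi.zero_apply] at hq
  simp only [mem_ofPred_eq]
  linarith

end Helpers

/-- identification under primitive restrictions only; linear-in-taste case.
Under the two-sided hedonic equilibrium condition with `ζ(ε,z) = ε·z`, twice continuously
differentiable `Ubar` and `C`, a uniform Hessian bound on the joint surplus, and an absolutely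
continuous taste distribution with finite second moment, no convexity restriction on the
potential is needed: any continuously differentiable `Ubar'` compatible with the data
`(με, μz, price)` satisfies `∇Ubar' = ∇Ubar`, `μz`-almost everywhere. -/
theorem stmt_6 {d m : ℕ}
    (Z : Set (EuclideanSpace ℝ (Fin d))) (hZc : IsCompact Z) (hZi : (interior Z).Nonempty)
    (Y : Set (EuclideanSpace ℝ (Fin m))) (hYc : IsCompact Y)
    (Ubar : EuclideanSpace ℝ (Fin d) → ℝ)
    (C : EuclideanSpace ℝ (Fin m) → EuclideanSpace ℝ (Fin d) → ℝ)
    (price : EuclideanSpace ℝ (Fin d) → ℝ)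
    (hU : ContDiff ℝ 2 Ubar)
    (hC : ContDiff ℝ 2 (fun q : EuclideanSpace ℝ (Fin m) × EuclideanSpace ℝ (Fin d) => C q.1 q.2))
    (M₁ : ℝ)
    (hHess : ∀ (ε : EuclideanSpace ℝ (Fin d)) (y : EuclideanSpace ℝ (Fin m))
      (z v : EuclideanSpace ℝ (Fin d)),
      ((fderiv ℝ (fderiv ℝ (fun w => (Ubar w + ⟪ε, w⟫) - C y w)) z) v) v ≤ M₁ * ‖v‖ ^ 2)
    (με : Measure (EuclideanSpace ℝ (Fin d))) [IsProbabilityMeasure με]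
    (μy : Measure (EuclideanSpace ℝ (Fin m))) [IsProbabilityMeasure μy]
    (hac : με ≪ volume) (hmom : Integrable (fun ε => ‖ε‖ ^ 2) με)
    (hμy : ∀ᵐ y ∂μy, y ∈ Y)
    (γ : Measure (EuclideanSpace ℝ (Fin d) × EuclideanSpace ℝ (Fin d) × EuclideanSpace ℝ (Fin m)))
    (hγ : IsProbabilityMeasure γ)
    (hγε : γ.map (fun q => q.1) = με)
    (hγy : γ.map (fun q => q.2.2) = μy)
    (heqm : ∀ᵐ q ∂γ, q.2.1 ∈ interior Z ∧
      IsMaxOn (fun z' => (Ubar z' + ⟪q.1, z'⟫) - price z') Z q.2.1 ∧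
      IsMaxOn (fun z' => price z' - C q.2.2 z') Z q.2.1)
    (hsel : ∃ sel : EuclideanSpace ℝ (Fin d) × EuclideanSpace ℝ (Fin m) → EuclideanSpace ℝ (Fin d),
      Measurable sel ∧ ∀ ε y, sel (ε, y) ∈ Z ∧
        IsMaxOn (fun z => (Ubar z + ⟪ε, z⟫) - C y z) Z (sel (ε, y))) :
    ∀ Ubar' : EuclideanSpace ℝ (Fin d) → ℝ, ContDiffOn ℝ 1 Ubar' Z →
      CompatibleLin Z price με (γ.map (fun q => q.2.1)) Ubar' →
      ∀ᵐ z ∂(γ.map (fun q => q.2.1)), fderiv ℝ Ubar' z = fderiv ℝ Ubar z := by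
  intro Ubar' hU' ⟨π', hπ'prob, hπ'1, hπ'2, hπ'max⟩
  have hCy : ∀ y, ContDiff ℝ 2 (C y) := fun y => hC.comp (contDiff_prodMk_right y)
  have hUc := hU.continuous
  have hpd : ∀ᵐ z ∂(γ.map fun q => q.2.1), z ∈ interior Z ∧ DifferentiableAt ℝ price z := by
    refine ae_map_of_continuous (μ := γ) (f := fun q => q.2.1) (by fun_prop) ?_
    filter_upwards [heqm] with q ⟨hz, hmaxU, hmaxC⟩
    have hnhds : Z ∈ nhds q.2.1 := mem_interior_iff_mem_nhds.1 hz
    refine ⟨hz, DifferentiableAt.of_eventually_le_of_eventually_le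
      (f := fun z => Ubar z + ⟪q.1, z⟫ - (Ubar q.2.1 + ⟪q.1, q.2.1⟫ - price q.2.1))
      (h := fun z => C q.2.2 z + (price q.2.1 - C q.2.2 q.2.1)) ?_ ?_ ?_ ?_ ?_ ?_⟩
    · exact ((hU.differentiable (by norm_num) _).add
        (innerSL ℝ q.1).differentiableAt).sub_const _
    · exact ((hCy _).differentiable (by norm_num) _).add_const _
    · filter_upwards [hnhds] with z hzZ
      have := hmaxU hzZ
      simp only [mem_ofPred_eq] at this
      linarith
    · filter_upwards [hnhds] with z hzZ
      have := hmaxC hzZ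
      simp only [mem_ofPred_eq] at this
      linarith
    · ring
    · ring
  obtain ⟨q₀, hq₀, hmaxU₀, hmaxC₀⟩ := heqm.exists
  have hbound : ∀ W : EuclideanSpace ℝ (Fin d) → ℝ, ContinuousOn W Z →
      ∃ K, ∀ z ∈ Z, |price z - W z| ≤ K := by
    intro W hW
    obtain ⟨K₁, hK₁⟩ := hZc.exists_bound_of_continuousOn
      (f := fun z => Ubar z + ⟪q₀.1, z⟫ - (Ubar q₀.2.1 + ⟪q₀.1, q₀.2.1⟫ - price q₀.2.1) - W z)
      (ContinuousOn.sub (Continuous.continuousOn (by fun_prop)) hW)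
    obtain ⟨K₂, hK₂⟩ := hZc.exists_bound_of_continuousOn
      (f := fun z => C q₀.2.2 z + (price q₀.2.1 - C q₀.2.2 q₀.2.1) - W z)
      (ContinuousOn.sub ((hCy _).continuous.add continuous_const).continuousOn hW)
    refine ⟨max K₁ K₂, fun z hz => ?_⟩
    have h1 := hmaxU₀ hz
    have h2 := hmaxC₀ hz
    have h3 := neg_le_of_abs_le (hK₁ z hz)
    have h4 := le_of_abs_le (hK₂ z hz)
    simp only [mem_ofPred_eq] at h1 h2
    rw [abs_le]
    exact ⟨by linarith [le_max_left K₁ K₂], by linarith [le_max_right K₁ K₂]⟩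
  set pair : EuclideanSpace ℝ (Fin d) × EuclideanSpace ℝ (Fin d) × EuclideanSpace ℝ (Fin m) →
    EuclideanSpace ℝ (Fin d) × EuclideanSpace ℝ (Fin d) := fun q => (q.1, q.2.1) with hpair
  have hpairc : Continuous pair := by fun_prop
  have : IsProbabilityMeasure (γ.map pair) :=
    Measure.isProbabilityMeasure_map hpairc.measurable.aemeasurable
  have hfst : (γ.map pair).map Prod.fst = με := by
    rw [Measure.map_map measurable_fst hpairc.measurable]
    exact hγε
  have hsnd : (γ.map pair).map Prod.snd = γ.map fun q => q.2.1 :=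
    Measure.map_map measurable_snd hpairc.measurable
  have hmax : ∀ᵐ q ∂(γ.map pair), q.2 ∈ Z ∧
      IsMaxOn (fun z => ⟪q.1, z⟫ - (price z - Ubar z)) Z q.2 := by
    refine ae_map_of_continuous hpairc ?_
    filter_upwards [heqm] with q ⟨hz, hmaxU, _⟩
    refine ⟨interior_subset hz, ?_⟩
    convert hmaxU using 2
    ring
  have hmax' : ∀ᵐ q ∂π', q.2 ∈ Z ∧
      IsMaxOn (fun z => ⟪q.1, z⟫ - (price z - Ubar' z)) Z q.2 := by
    filter_upwards [hπ'max] with q ⟨hz, hmaxU⟩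
    refine ⟨interior_subset hz, ?_⟩
    convert hmaxU using 2
    ring
  have hmom1 : Integrable (fun ε => ‖ε‖) με := by
    refine ((integrable_const (1 : ℝ)).add hmom).mono' continuous_norm.aestronglyMeasurable
      (ae_of_all _ fun ε => ?_)
    simp only [norm_norm, Pi.add_apply]
    nlinarith [sq_nonneg (‖ε‖ - 1), norm_nonneg ε]
  obtain ⟨K, hK⟩ := hbound Ubar hUc.continuousOn
  obtain ⟨K', hK'⟩ := hbound Ubar' hU'.continuousOn
  have hle := (integral_inner_le_and_ae_isMaxOn hZc.isBounded hK' (hπ'1 ▸ hmom1)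
    (hfst.trans hπ'1.symm) (hsnd.trans hπ'2.symm) hmax' (hmax.mono fun q hq => hq.1)).1
  have hopt := (integral_inner_le_and_ae_isMaxOn hZc.isBounded hK (hfst ▸ hmom1)
    (hπ'1.trans hfst.symm) (hπ'2.trans hsnd.symm) hmax (hmax'.mono fun q hq => hq.1)).2 hle
  have hpd' : ∀ᵐ q ∂π', DifferentiableAt ℝ price q.2 := by
    rw [← hπ'2] at hpd
    exact (ae_of_ae_map measurable_snd.aemeasurable hpd).mono fun q hq => hq.2
  rw [← hπ'2]
  refine ae_map_of_continuous (μ := π') continuous_snd ?_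
  filter_upwards [hopt, hpd', hπ'max] with q hq hqp ⟨hz, hmaxU'⟩
  have hdU' : DifferentiableAt ℝ Ubar' q.2 :=
    (hU'.differentiableOn (by norm_num)).differentiableAt (mem_interior_iff_mem_nhds.1 hz)
  have hmaxU : IsMaxOn (fun z => Ubar z + ⟪q.1, z⟫ - price z) Z q.2 := by
    convert hq using 2
    ring
  rw [fderiv_add_inner_eq_of_isMaxOn hz hdU' hqp hmaxU',
    fderiv_add_inner_eq_of_isMaxOn hz (hU.differentiable (by norm_num) _) hqp hmaxU]
end

section
/- In the nonlinear simultaneous equations model z = h(ε) with z, ε ∈ ℝ^d (observable covariates held fixed), the structural function h is nonparametrically identified within the class of gradients of convex functions: if μ_ε is absolutely continuous with respect to Lebesgue measure and μ_ε and its image measure have finite second moments, and if h₁ = ∇φ₁ and h₂ = ∇φ₂ are gradients of convex functions φ₁, φ₂ : ℝ^d → ℝ (defined μ_ε-almost everywhere) whose pushforwards of μ_ε coincide (h₁#μ_ε = h₂#μ_ε), then h₁(ε) = h₂(ε) for μ_ε-almost every ε. -/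
open MeasureTheory Set

open scoped RealInnerProductSpace

section ConvexGradient

variable {E : Type*} [NormedAddCommGroup E] [InnerProductSpace ℝ E]

/-- The gradient of a convex function is a subgradient. -/
theorem ConvexOn.add_inner_gradient_le [CompleteSpace E] {φ : E → ℝ} (hφ : ConvexOn ℝ univ φ)
    {x g : E} (hg : HasGradientAt φ g x) (y : E) : φ x + ⟪y - x, g⟫ ≤ φ y := by
  have hconv : ConvexOn ℝ univ (φ ∘ AffineMap.lineMap (k := ℝ) x y) := by
    simpa using hφ.comp_affineMap (AffineMap.lineMap (k := ℝ) x y)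
  have hderiv : HasDerivAt (φ ∘ AffineMap.lineMap (k := ℝ) x y) ⟪g, y - x⟫ 0 := by
    have hline : HasDerivAt (AffineMap.lineMap (k := ℝ) x y) (y - x) (0 : ℝ) :=
      AffineMap.hasDerivAt_lineMap
    have hfd : HasFDerivAt φ (InnerProductSpace.toDual ℝ E g)
        (AffineMap.lineMap (k := ℝ) x y (0 : ℝ)) := by
      simpa using hg.hasFDerivAt
    simpa using hfd.comp_hasDerivAt (0 : ℝ) hline
  have hslope := hconv.le_slope_of_hasDerivAt (mem_univ 0) (mem_univ 1) one_pos hderiv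
  simp only [slope_def_field, Function.comp_apply, AffineMap.lineMap_apply_one,
    AffineMap.lineMap_apply_zero, sub_zero, div_one] at hslope
  rw [real_inner_comm]
  linarith

/-- A differentiable function lying above an affine function that touches it at `x` has the slope
of that affine function as its gradient at `x`. -/
theorem HasGradientAt.eq_of_forall_inner_sub_le [CompleteSpace E] {φ : E → ℝ} {x g p : E}
    (hg : HasGradientAt φ g x) (hp : ∀ y, ⟪y, p⟫ - φ y ≤ ⟪x, p⟫ - φ x) : g = p := by
  have hmin : IsLocalMin (fun y => φ y - ⟪p, y⟫) x := by
    refine Filter.Eventually.of_forall fun y => ?_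
    have := hp y
    rw [real_inner_comm p y, real_inner_comm p x] at *
    linarith
  have hfd := hg.hasFDerivAt.sub (InnerProductSpace.toDual ℝ E p).hasFDerivAt
  have hzero := hmin.hasFDerivAt_eq_zero hfd
  exact (InnerProductSpace.toDual ℝ E).injective (sub_eq_zero.1 hzero)

theorem ConvexOn.continuous_of_univ [FiniteDimensional ℝ E] {φ : E → ℝ}
    (hφ : ConvexOn ℝ univ φ) : Continuous φ :=
  continuousOn_univ.1 (hφ.continuousOn isOpen_univ)

variable [MeasurableSpace E] [BorelSpace E] {μ : Measure E}

theorem integrable_inner_of_integrable_sq_norm [SecondCountableTopology E] {h : E → E}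
    (hm : Measurable h) (hmom : Integrable (fun x => ‖x‖ ^ 2) μ)
    (hmomh : Integrable (fun x => ‖h x‖ ^ 2) μ) : Integrable (fun x => ⟪x, h x⟫) μ := by
  refine (hmom.add hmomh).mono' (measurable_id.inner hm).aestronglyMeasurable
    (Filter.Eventually.of_forall fun x => ?_)
  have h₁ := norm_inner_le_norm (𝕜 := ℝ) x (h x)
  simp only [Pi.add_apply]
  nlinarith [sq_nonneg (‖x‖ - ‖h x‖), sq_nonneg ‖x‖, sq_nonneg ‖h x‖]

variable [FiniteDimensional ℝ E] {φ : E → ℝ} {h h' : E → E}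

theorem ConvexOn.integrable_of_hasGradientAt [IsProbabilityMeasure μ] (hφ : ConvexOn ℝ univ φ)
    (hg : ∀ᵐ x ∂μ, HasGradientAt φ (h x) x) (hmom : Integrable (fun x => ‖x‖ ^ 2) μ)
    (hint : Integrable (fun x => ⟪x, h x⟫) μ) : Integrable φ μ := by
  obtain ⟨x₀, hx₀⟩ := hg.exists
  have hid : Integrable (fun x : E => x) μ :=
    ((memLp_two_iff_integrable_sq_norm aestronglyMeasurable_id).2 hmom).integrable one_le_two
  have haff : Integrable (fun x => φ x₀ + ⟪x - x₀, h x₀⟫) μ :=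
    (integrable_const _).add ((hid.sub (integrable_const x₀)).inner_const _)
  refine integrable_of_le_of_le hφ.continuous_of_univ.aestronglyMeasurable
    (Filter.Eventually.of_forall fun x => hφ.add_inner_gradient_le hx₀ x) ?_ haff
    ((integrable_const (φ 0)).add hint)
  filter_upwards [hg] with x hx
  have := hφ.add_inner_gradient_le hx 0
  simp only [zero_sub, inner_neg_left] at this
  simp only [Pi.add_apply]
  linarith

/-- A measurable real-valued version of the Legendre transform of a convex function, defined almost
everywhere for the image of `μ` under the gradient. -/
theorem ConvexOn.exists_measurable_conjugate (hφ : ConvexOn ℝ univ φ) (hm : Measurable h)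
    (hg : ∀ᵐ x ∂μ, HasGradientAt φ (h x) x) :
    ∃ ψ : E → ℝ, Measurable ψ ∧ (∀ᵐ x ∂μ, ψ (h x) = ⟪x, h x⟫ - φ x) ∧
      ∀ᵐ z ∂μ.map h, ∀ y, ⟪y, z⟫ - φ y ≤ ψ z := by
  let u := TopologicalSpace.denseSeq E
  let f : ℕ → E → ℝ := fun n z => ⟪u n, z⟫ - φ (u n)
  have hf : ∀ n, Measurable (f n) := fun n =>
    (measurable_const.inner measurable_id).sub measurable_const
  have hle : ∀ z c, (∀ n, f n z ≤ c) → ∀ y, ⟪y, z⟫ - φ y ≤ c := by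
    intro z c hc y
    have hcont : Continuous fun y => ⟪y, z⟫ - φ y :=
      (continuous_id.inner continuous_const).sub hφ.continuous_of_univ
    exact (TopologicalSpace.denseRange_denseSeq E).induction_on
      (p := fun y => ⟪y, z⟫ - φ y ≤ c) y (isClosed_le hcont continuous_const) hc
  have hsub : ∀ x, HasGradientAt φ (h x) x → ∀ y, ⟪y, h x⟫ - φ y ≤ ⟪x, h x⟫ - φ x := by
    intro x hx y
    have := hφ.add_inner_gradient_le hx y
    rw [inner_sub_left] at this
    linarith
  have hbdd : ∀ z, BddAbove (range fun n => f n z) → ∀ y, ⟪y, z⟫ - φ y ≤ ⨆ n, f n z :=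
    fun z hz => hle z _ fun n => le_ciSup hz n
  have hbddh : ∀ x, HasGradientAt φ (h x) x → BddAbove (range fun n => f n (h x)) := by
    rintro x hx
    refine ⟨⟪x, h x⟫ - φ x, ?_⟩
    rintro _ ⟨n, rfl⟩
    exact hsub x hx (u n)
  refine ⟨fun z => ⨆ n, f n z, Measurable.iSup hf, ?_, ?_⟩
  · filter_upwards [hg] with x hx
    exact le_antisymm (ciSup_le fun n => hsub x hx (u n)) (hbdd _ (hbddh x hx) x)
  · have : ∀ᵐ z ∂μ.map h, BddAbove (range fun n => f n z) :=
      (ae_map_iff hm.aemeasurable (measurableSet_bddAbove_range hf)).2 (hg.mono hbddh)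
    exact this.mono hbdd

/-- If `h` is the gradient of a convex function and `h'` has the same image measure, then the
correlation of `h'` with the identity is at most that of `h`, with equality only if
`h' = h` almost everywhere. -/
theorem ConvexOn.integral_inner_le_and_ae_eq [IsProbabilityMeasure μ] (hφ : ConvexOn ℝ univ φ)
    (hm : Measurable h) (hm' : Measurable h') (hg : ∀ᵐ x ∂μ, HasGradientAt φ (h x) x)
    (hmom : Integrable (fun x => ‖x‖ ^ 2) μ) (hint : Integrable (fun x => ⟪x, h x⟫) μ)
    (hint' : Integrable (fun x => ⟪x, h' x⟫) μ) (hpush : μ.map h = μ.map h') :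
    ∫ x, ⟪x, h' x⟫ ∂μ ≤ ∫ x, ⟪x, h x⟫ ∂μ ∧
      (∫ x, ⟪x, h' x⟫ ∂μ = ∫ x, ⟪x, h x⟫ ∂μ → ∀ᵐ x ∂μ, h x = h' x) := by
  obtain ⟨ψ, hψ, hψh, hψle⟩ := hφ.exists_measurable_conjugate hm hg
  have hφi : Integrable φ μ := hφ.integrable_of_hasGradientAt hg hmom hint
  have hψi : Integrable (fun x => ψ (h x)) μ := (hint.sub hφi).congr (hψh.mono fun x hx => hx.symm)
  have hψi' : Integrable (fun x => ψ (h' x)) μ := by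
    have : Integrable ψ (μ.map h) :=
      (integrable_map_measure hψ.aestronglyMeasurable hm.aemeasurable).2 hψi
    rw [hpush] at this
    exact (integrable_map_measure hψ.aestronglyMeasurable hm'.aemeasurable).1 this
  have hψeq : ∫ x, ψ (h x) ∂μ = ∫ x, ψ (h' x) ∂μ := by
    rw [← integral_map hm.aemeasurable hψ.aestronglyMeasurable, hpush,
      integral_map hm'.aemeasurable hψ.aestronglyMeasurable]
  have hψh_int : ∫ x, ψ (h x) ∂μ = ∫ x, ⟪x, h x⟫ ∂μ - ∫ x, φ x ∂μ := by
    rw [integral_congr_ae hψh, integral_sub hint hφi]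
  rw [hpush] at hψle
  have hψle' : ∀ᵐ x ∂μ, ∀ y, ⟪y, h' x⟫ - φ y ≤ ψ (h' x) := ae_of_ae_map hm'.aemeasurable hψle
  have hle : (fun x => ⟪x, h' x⟫ - φ x) ≤ᵐ[μ] fun x => ψ (h' x) := hψle'.mono fun x hx => hx x
  have hsub : ∫ x, (⟪x, h' x⟫ - φ x) ∂μ = ∫ x, ⟪x, h' x⟫ ∂μ - ∫ x, φ x ∂μ :=
    integral_sub hint' hφi
  refine ⟨?_, fun heq => ?_⟩
  · have := integral_mono_ae (hint'.sub hφi) hψi' hle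
    simp only [Pi.sub_apply] at this
    linarith
  · have hae := (integral_eq_iff_of_ae_le (hint'.sub hφi) hψi' hle).1 (by
      simp only [Pi.sub_apply]
      linarith)
    filter_upwards [hg, hψle', hae] with x hx hxle hxeq
    exact hx.eq_of_forall_inner_sub_le fun y => (hxle y).trans hxeq.ge

end ConvexGradient

/-- nonlinear simultaneous equations: identification within gradients of
convex functions; Brenier uniqueness. If `με` is absolutely continuous with finite second
moment, the image measure has finite second moment, and `h₁`, `h₂` agree `με`-a.e. with the
gradients of convex functions `φ₁`, `φ₂` and push `με` forward to the same distribution,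
then `h₁ = h₂`, `με`-almost everywhere. -/
theorem stmt_7 {d : ℕ}
    (με : Measure (EuclideanSpace ℝ (Fin d))) [IsProbabilityMeasure με]
    (hac : με ≪ volume)
    (φ₁ φ₂ : EuclideanSpace ℝ (Fin d) → ℝ)
    (hφ₁ : ConvexOn ℝ Set.univ φ₁) (hφ₂ : ConvexOn ℝ Set.univ φ₂)
    (h₁ h₂ : EuclideanSpace ℝ (Fin d) → EuclideanSpace ℝ (Fin d))
    (hm₁ : Measurable h₁) (hm₂ : Measurable h₂)
    (hg₁ : ∀ᵐ ε ∂με, HasGradientAt φ₁ (h₁ ε) ε)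
    (hg₂ : ∀ᵐ ε ∂με, HasGradientAt φ₂ (h₂ ε) ε)
    (hmom : Integrable (fun ε => ‖ε‖ ^ 2) με)
    (hmomz : Integrable (fun z => ‖z‖ ^ 2) (με.map h₁))
    (hpush : με.map h₁ = με.map h₂) :
    ∀ᵐ ε ∂με, h₁ ε = h₂ ε := by
  have hmom₁ : Integrable (fun ε => ‖h₁ ε‖ ^ 2) με := hmomz.comp_measurable hm₁
  have hmom₂ : Integrable (fun ε => ‖h₂ ε‖ ^ 2) με := (hpush ▸ hmomz).comp_measurable hm₂
  have hint₁ := integrable_inner_of_integrable_sq_norm hm₁ hmom hmom₁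
  have hint₂ := integrable_inner_of_integrable_sq_norm hm₂ hmom hmom₂
  obtain ⟨hle₁, hae⟩ :=
    hφ₁.integral_inner_le_and_ae_eq hm₁ hm₂ hg₁ hmom hint₁ hint₂ hpush
  obtain ⟨hle₂, -⟩ :=
    hφ₂.integral_inner_le_and_ae_eq hm₂ hm₁ hg₂ hmom hint₂ hint₁ hpush.symm
  exact hae (le_antisymm hle₁ hle₂)
end

section
/- Suppose the two-sided hedonic equilibrium condition holds, that Ū, ζ and C are twice continuously differentiable, that there is a constant M₁ with D²_{zz}(U(ε,z) − C(ỹ,z)) ≤ M₁·Id as quadratic forms for all (ε,z,ỹ), that μ_ε is absolutely continuous with respect to Lebesgue measure, that ε ↦ ∇_zζ(ε,z) is injective for each z (Twist condition), that z ↦ ∇_εζ(ε,z) is injective on Z for each ε, that ‖∇_zζ(ε,z)‖ → ∞ as ‖ε‖ → ∞ uniformly in z ∈ Z, and that the matrix D²_{εz}ζ(ε,z) is invertible for all (ε,z) with ‖(D²_{εz}ζ(ε,z))⁻¹‖ ≤ M₀ for a uniform constant M₀. Then the endogenous distribution μ_z of qualities traded at equilibrium is absolutely continuous with respect to Lebesgue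 measure on ℝ^d. -/
open MeasureTheory Set

open Metric Filter
open scoped Topology NNReal

/-- A family of `C²` functions is locally approximated to second order by its first-order
expansion, uniformly in the parameter. -/
lemma exists_ball_abs_sub_fderiv_le {A E : Type*} [NormedAddCommGroup A] [NormedSpace ℝ A]
    [NormedAddCommGroup E] [NormedSpace ℝ E] {f : A → E → ℝ}
    (hf : ContDiff ℝ 2 (fun q : A × E => f q.1 q.2)) (a₀ : A) (z₀ : E) :
    ∃ K : ℝ, 0 ≤ K ∧ ∃ r > 0, ∀ a ∈ ball a₀ r, ∀ z ∈ ball z₀ r, ∀ x ∈ ball z₀ r,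
      |f a x - f a z - fderiv ℝ (f a) z (x - z)| ≤ K * ‖x - z‖ ^ 2 := by
  have hF : ContDiff ℝ 1 (fun q : A × E => fderiv ℝ (f q.1) q.2) :=
    ContDiff.fderiv (m := 2) (f := fun (q : A × E) w => f q.1 w)
      (hf.comp ((contDiff_fst.comp contDiff_fst).prodMk contDiff_snd)) contDiff_snd
      (by norm_num)
  obtain ⟨K, t, ht, hK⟩ := (hF.contDiffAt (x := (a₀, z₀))).exists_lipschitzOnWith
  obtain ⟨r, hr, hrt⟩ := Metric.mem_nhds_iff.1 ht
  refine ⟨K, K.2, r, hr, fun a ha z hz x hx => ?_⟩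
  have hmem : ∀ w ∈ ball z₀ r, (a, w) ∈ t := fun w hw =>
    hrt (by rw [← ball_prod_same]; exact ⟨ha, hw⟩)
  have hseg : segment ℝ z x ⊆ ball z₀ r := (convex_ball z₀ r).segment_subset hz hx
  have hdiff : Differentiable ℝ (f a) :=
    (hf.comp (contDiff_const.prodMk contDiff_id)).differentiable (by norm_num)
  have := Convex.norm_image_sub_le_of_norm_fderiv_le' (𝕜 := ℝ) (f := f a)
    (φ := fderiv ℝ (f a) z) (C := K * ‖x - z‖) (s := segment ℝ z x) (fun w _ => hdiff w)
    (fun w hw => by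
      have h := hK.dist_le_mul _ (hmem w (hseg hw)) _ (hmem z hz)
      simp only [dist_eq_norm, Prod.mk_sub_mk, sub_self, Prod.norm_def, norm_zero] at h
      rw [max_eq_right (norm_nonneg _)] at h
      refine h.trans (mul_le_mul_of_nonneg_left ?_ K.2)
      exact norm_sub_le_of_mem_segment hw)
    (convex_segment z x) (left_mem_segment ℝ z x) (right_mem_segment ℝ z x)
  rw [Real.norm_eq_abs] at this
  linarith [this]

/-- If a function has second-order supports `g₁` at `z₁` and `g₂` at `z₂`, then `g₁` and `g₂`
are close. -/
lemma norm_sub_le_of_quadratic_bounds {E : Type*} [NormedAddCommGroup E] [NormedSpace ℝ E]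
    {p : E → ℝ} {z₁ z₂ : E} {g₁ g₂ : E →L[ℝ] ℝ} {K t : ℝ} (hK : 0 ≤ K) (ht : 0 < t)
    (hz : ‖z₁ - z₂‖ ≤ t)
    (hlow : ∀ x ∈ closedBall z₂ t, p z₁ + g₁ (x - z₁) - K * ‖x - z₁‖ ^ 2 ≤ p x)
    (hup : ∀ x ∈ closedBall z₂ t, p x ≤ p z₂ + g₂ (x - z₂) + K * ‖x - z₂‖ ^ 2)
    (hup' : p z₂ ≤ p z₁ + g₁ (z₂ - z₁) + K * ‖z₂ - z₁‖ ^ 2) :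
    ‖g₁ - g₂‖ ≤ 6 * K * t := by
  have key : ∀ u : E, ‖u‖ = 1 → (g₁ - g₂) u ≤ 6 * K * t := by
    intro u hu
    have hnorm : ‖t • u‖ = t := by rw [norm_smul, hu, Real.norm_of_nonneg ht.le, mul_one]
    have hx : z₂ + t • u ∈ closedBall z₂ t := by
      simp [mem_closedBall, dist_eq_norm, hnorm]
    have h1 := hlow _ hx
    have h2 := hup _ hx
    have e : z₂ + t • u - z₁ = (z₂ - z₁) + t • u := by abel
    rw [norm_sub_rev] at hz
    have h3 : ‖z₂ + t • u - z₁‖ ≤ 2 * t := by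
      rw [e]
      exact (norm_add_le _ _).trans (by linarith)
    have h3' : ‖z₂ + t • u - z₁‖ ^ 2 ≤ (2 * t) ^ 2 := by gcongr
    have h4' : ‖z₂ - z₁‖ ^ 2 ≤ t ^ 2 := by gcongr
    have h3K := mul_le_mul_of_nonneg_left h3' hK
    have h4K := mul_le_mul_of_nonneg_left h4' hK
    rw [e, map_add, map_smul, smul_eq_mul, ← e] at h1
    rw [add_sub_cancel_left, map_smul, smul_eq_mul, hnorm] at h2
    have : t * (g₁ u - g₂ u) ≤ t * (6 * K * t) := by nlinarith
    simpa using le_of_mul_le_mul_left this ht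
  refine ContinuousLinearMap.opNorm_le_of_unit_norm (by positivity) fun u hu => ?_
  rw [Real.norm_eq_abs, abs_le]
  have := key (-u) (by simpa using hu)
  rw [map_neg] at this
  exact ⟨by linarith, key u hu⟩

/-- Local implicit-function estimate: if the partial derivative of `Φ` in its first variable has
a left inverse, then increments of the first variable are controlled by those of `Φ` and of the
second variable. -/
lemma HasStrictFDerivAt.exists_norm_fst_sub_le {E F G : Type*} [NormedAddCommGroup E]
    [NormedSpace ℝ E] [NormedAddCommGroup F] [NormedSpace ℝ F] [NormedAddCommGroup G]
    [NormedSpace ℝ G] {Φ : E × F → G} {L : E × F →L[ℝ] G} {p : E × F}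
    (hΦ : HasStrictFDerivAt Φ L p) (A : G →L[ℝ] E) (hA : ∀ v, A (L (v, 0)) = v) :
    ∃ c : ℝ, 0 ≤ c ∧ ∃ s ∈ 𝓝 p, ∀ a ∈ s, ∀ b ∈ s,
      ‖a.1 - b.1‖ ≤ c * (‖Φ a - Φ b‖ + ‖a.2 - b.2‖) := by
  let c : ℝ≥0 := ⟨1 / (2 * (‖A‖ + 1)), by positivity⟩
  have hc : (c : ℝ) = 1 / (2 * (‖A‖ + 1)) := rfl
  have hc0 : 0 < c := by
    rw [← NNReal.coe_pos, hc]; positivity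
  obtain ⟨s, hs, happ⟩ := hΦ.approximates_deriv_on_nhds (c := c) (Or.inr hc0)
  have hAc : ‖A‖ * c ≤ 1 / 2 := by
    rw [hc, mul_one_div, div_le_iff₀ (by positivity)]
    linarith [norm_nonneg A]
  refine ⟨2 * (‖A‖ * (1 + ‖L‖) + 1), by positivity, s, hs, fun a ha b hb => ?_⟩
  have h1 := happ a ha b hb
  have hsplit : L (a - b) = L (a.1 - b.1, 0) + L (0, a.2 - b.2) := by
    rw [← map_add]; congr 1; simp [Prod.ext_iff]
  have h2 : a.1 - b.1 = A ((Φ a - Φ b) - L (0, a.2 - b.2) - (Φ a - Φ b - L (a - b))) := by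
    conv_lhs => rw [← hA (a.1 - b.1)]
    congr 1
    rw [hsplit]; abel
  have h3 : ‖L (0, a.2 - b.2)‖ ≤ ‖L‖ * ‖a.2 - b.2‖ := by
    refine (L.le_opNorm _).trans_eq ?_
    simp [Prod.norm_def]
  have h4 : ‖a - b‖ ≤ ‖a.1 - b.1‖ + ‖a.2 - b.2‖ := by
    rw [Prod.norm_def]
    exact max_le_add_of_nonneg (norm_nonneg _) (norm_nonneg _)
  have h5 : ‖a.1 - b.1‖ ≤ ‖A‖ * (‖Φ a - Φ b‖ + ‖L‖ * ‖a.2 - b.2‖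
      + c * (‖a.1 - b.1‖ + ‖a.2 - b.2‖)) := by
    conv_lhs => rw [h2]
    refine (A.le_opNorm _).trans (mul_le_mul_of_nonneg_left ?_ (norm_nonneg A))
    refine (norm_sub_le _ _).trans (add_le_add ((norm_sub_le _ _).trans (by gcongr)) ?_)
    exact h1.trans (by gcongr)
  have h6 : ‖A‖ * c * (‖a.1 - b.1‖ + ‖a.2 - b.2‖) ≤ 1 / 2 * (‖a.1 - b.1‖ + ‖a.2 - b.2‖) := by
    gcongr
  have h7 : 0 ≤ ‖A‖ * ‖L‖ * ‖Φ a - Φ b‖ := by positivity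
  have h8 : 0 ≤ ‖A‖ * ‖a.2 - b.2‖ := by positivity
  nlinarith [norm_nonneg (a.2 - b.2), norm_nonneg (Φ a - Φ b)]

/-- In a finite-dimensional space, a relation along which the first coordinate depends in a
Lipschitz way on the second one sends null sets to null sets. -/
lemma volume_image_eq_zero_of_lipschitz_relation {α E : Type*} [NormedAddCommGroup E]
    [InnerProductSpace ℝ E] [FiniteDimensional ℝ E] [MeasurableSpace E] [BorelSpace E]
    {S : Set α} {f g : α → E} {c : ℝ≥0}
    (hfg : ∀ a ∈ S, ∀ b ∈ S, dist (f a) (f b) ≤ c * dist (g a) (g b))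
    (hnull : volume (g '' S) = 0) : volume (f '' S) = 0 := by
  rcases S.eq_empty_or_nonempty with rfl | ⟨a₀, -⟩
  · simp
  have : Nonempty α := ⟨a₀⟩
  have hfac : ∀ z ∈ g '' S, ∃ a ∈ S, g a = z := fun z hz => hz
  choose! h hS hg using hfac
  have hlip : LipschitzOnWith c (f ∘ h) (g '' S) := by
    refine LipschitzOnWith.of_dist_le_mul fun x hx y hy => ?_
    simpa [hg x hx, hg y hy] using hfg _ (hS x hx) _ (hS y hy)
  have hsub : f '' S ⊆ (f ∘ h) '' (g '' S) := by
    rintro _ ⟨a, ha, rfl⟩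
    have hga := mem_image_of_mem g ha
    refine ⟨g a, hga, ?_⟩
    have := hfg _ (hS _ hga) _ ha
    rw [hg _ hga, dist_self, mul_zero] at this
    exact dist_le_zero.1 this
  have hH : (Measure.hausdorffMeasure (Module.finrank ℝ E) : Measure E) (g '' S) = 0 :=
    Measure.absolutelyContinuous_isAddHaarMeasure _ volume hnull
  refine Measure.absolutelyContinuous_isAddHaarMeasure volume
    (Measure.hausdorffMeasure (Module.finrank ℝ E)) (measure_mono_null hsub ?_)
  refine le_antisymm ((hlip.hausdorffMeasure_image_le (Nat.cast_nonneg _)).trans ?_) bot_le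
  rw [hH, mul_zero]

/-- Gradients of the utility at equilibrium points are Lipschitz in the traded quality: `u` and
`k` are the utility and the cost, and `hmax` says that the quality maximizes both sides' gains. -/
lemma exists_ball_norm_fderiv_sub_le {A B E : Type*} [NormedAddCommGroup A] [NormedSpace ℝ A]
    [NormedAddCommGroup B] [NormedSpace ℝ B] [NormedAddCommGroup E] [NormedSpace ℝ E]
    {u : A → E → ℝ} {k : B → E → ℝ} {p : E → ℝ} {Z : Set E}
    (hu : ContDiff ℝ 2 (fun q : A × E => u q.1 q.2))
    (hk : ContDiff ℝ 2 (fun q : B × E => k q.1 q.2))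
    {S : Set (A × E × B)}
    (hmax : ∀ q ∈ S, q.2.1 ∈ interior Z ∧ IsMaxOn (fun z => u q.1 z - p z) Z q.2.1 ∧
      IsMaxOn (fun z => p z - k q.2.2 z) Z q.2.1)
    {q₀ : A × E × B} (hq₀ : q₀ ∈ S) :
    ∃ K : ℝ, 0 ≤ K ∧ ∃ V ∈ 𝓝 q₀, ∀ q ∈ V ∩ S, ∀ q' ∈ V ∩ S,
      ‖fderiv ℝ (u q.1) q.2.1 - fderiv ℝ (u q'.1) q'.2.1‖ ≤ K * ‖q.2.1 - q'.2.1‖ := by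
  obtain ⟨a₀, z₀, b₀⟩ := q₀
  obtain ⟨K₁, hK₁, r₁, hr₁, h₁⟩ := exists_ball_abs_sub_fderiv_le hu a₀ z₀
  obtain ⟨K₂, hK₂, r₂, hr₂, h₂⟩ := exists_ball_abs_sub_fderiv_le hk b₀ z₀
  obtain ⟨r₃, hr₃, h₃⟩ := Metric.mem_nhds_iff.1
    (mem_interior_iff_mem_nhds.1 (hmax _ hq₀).1)
  obtain ⟨r, hr, hrr₁, hrr₂, hrr₃⟩ : ∃ r > 0, r ≤ r₁ ∧ r ≤ r₂ ∧ r ≤ r₃ :=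
    ⟨min r₁ (min r₂ r₃), by positivity, by simp, by simp, by simp⟩
  have hud : ∀ a, Differentiable ℝ (u a) := fun a =>
    (hu.comp (contDiff_const.prodMk contDiff_id)).differentiable (by norm_num)
  have hkd : ∀ b, Differentiable ℝ (k b) := fun b =>
    (hk.comp (contDiff_const.prodMk contDiff_id)).differentiable (by norm_num)
  have hfoc : ∀ q ∈ S, fderiv ℝ (k q.2.2) q.2.1 = fderiv ℝ (u q.1) q.2.1 := by
    intro q hq
    obtain ⟨hi, hm, hm'⟩ := hmax q hq
    have hloc : IsLocalMax (u q.1 - k q.2.2) q.2.1 := by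
      refine IsMaxOn.isLocalMax (s := Z) (fun x hx => ?_) (mem_interior_iff_mem_nhds.1 hi)
      have e1 := hm hx
      have e2 := hm' hx
      simp only [mem_ofPred_eq, Pi.sub_apply] at e1 e2 ⊢
      linarith
    have := hloc.fderiv_eq_zero
    rw [fderiv_sub (hud _ _) (hkd _ _), sub_eq_zero] at this
    exact this.symm
  have hlow : ∀ q ∈ (ball a₀ r ×ˢ ball z₀ (r / 4) ×ˢ ball b₀ r) ∩ S, ∀ x ∈ ball z₀ r,
      p q.2.1 + fderiv ℝ (u q.1) q.2.1 (x - q.2.1) - (K₁ + K₂) * ‖x - q.2.1‖ ^ 2 ≤ p x ∧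
      p x ≤ p q.2.1 + fderiv ℝ (u q.1) q.2.1 (x - q.2.1) + (K₁ + K₂) * ‖x - q.2.1‖ ^ 2 := by
    rintro q ⟨⟨hq1, hq2, hq3⟩, hq⟩ x hx
    have hz : q.2.1 ∈ ball z₀ r := ball_subset_ball (by linarith) hq2
    have hxZ : x ∈ Z := h₃ (ball_subset_ball hrr₃ hx)
    have e1 := (hmax q hq).2.1 hxZ
    have e2 := (hmax q hq).2.2 hxZ
    simp only [mem_ofPred_eq] at e1 e2
    have f1 := abs_le.1 (h₁ _ (ball_subset_ball hrr₁ hq1) _ (ball_subset_ball hrr₁ hz) x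
      (ball_subset_ball hrr₁ hx))
    have f2 := abs_le.1 (h₂ _ (ball_subset_ball hrr₂ hq3) _ (ball_subset_ball hrr₂ hz) x
      (ball_subset_ball hrr₂ hx))
    rw [hfoc q hq] at f2
    have := mul_nonneg hK₁ (sq_nonneg ‖x - q.2.1‖)
    have := mul_nonneg hK₂ (sq_nonneg ‖x - q.2.1‖)
    constructor <;> linarith [f1.1, f2.2]
  refine ⟨6 * (K₁ + K₂), by positivity, ball a₀ r ×ˢ ball z₀ (r / 4) ×ˢ ball b₀ r,
    prod_mem_nhds (ball_mem_nhds _ hr)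
      (prod_mem_nhds (ball_mem_nhds _ (by positivity)) (ball_mem_nhds _ hr)), ?_⟩
  intro q hq q' hq'
  have hz := mem_ball.1 hq.1.2.1
  have hz' := mem_ball.1 hq'.1.2.1
  have hδ : ‖q.2.1 - q'.2.1‖ < r / 2 := by
    rw [← dist_eq_norm]
    linarith [dist_triangle_right q.2.1 q'.2.1 z₀]
  have hlim : Tendsto (fun t : ℝ => 6 * (K₁ + K₂) * t) (𝓝[>] ‖q.2.1 - q'.2.1‖)
      (𝓝 (6 * (K₁ + K₂) * ‖q.2.1 - q'.2.1‖)) :=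
    ((continuous_const.mul continuous_id).tendsto _).mono_left nhdsWithin_le_nhds
  refine ge_of_tendsto hlim ?_
  filter_upwards [Ioo_mem_nhdsGT hδ] with t ht
  have hsub : closedBall q'.2.1 t ⊆ ball z₀ r := fun x hx => by
    rw [mem_closedBall] at hx
    rw [mem_ball]
    linarith [dist_triangle x q'.2.1 z₀, ht.2]
  exact norm_sub_le_of_quadratic_bounds (p := p) (add_nonneg hK₁ hK₂)
    ((norm_nonneg _).trans_lt ht.1) ht.1.le
    (fun x hx => (hlow q hq x (hsub hx)).1) (fun x hx => (hlow q' hq' x (hsub hx)).2)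
    (hlow q hq _ (ball_subset_ball (by linarith) hq'.1.2.1)).2

/-- absolute continuity of the equilibrium quality distribution, general
surplus. Under the two-sided hedonic equilibrium condition, with twice continuously
differentiable `Ubar`, `ζ`, `C`, a uniform upper bound `M₁·Id` on the Hessian in `z` of the
joint surplus, an absolutely continuous taste distribution, the Twist condition (injectivity
of `ε ↦ ∇_zζ(ε,z)`), injectivity of `z ↦ ∇_εζ(ε,z)` on `Z`, the coercivity condition
`‖∇_zζ(ε,z)‖ → ∞` as `‖ε‖ → ∞` uniformly in `z ∈ Z`, and invertibility of the mixed second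
derivative `D²_{εz}ζ` with inverse uniformly bounded by `M₀`, the distribution of traded
qualities is absolutely continuous with respect to Lebesgue measure. -/
theorem stmt_8 {d m : ℕ}
    (Z : Set (EuclideanSpace ℝ (Fin d))) (hZc : IsCompact Z) (hZi : (interior Z).Nonempty)
    (Y : Set (EuclideanSpace ℝ (Fin m))) (hYc : IsCompact Y)
    (Ubar : EuclideanSpace ℝ (Fin d) → ℝ)
    (ζ : EuclideanSpace ℝ (Fin d) → EuclideanSpace ℝ (Fin d) → ℝ)
    (C : EuclideanSpace ℝ (Fin m) → EuclideanSpace ℝ (Fin d) → ℝ)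
    (price : EuclideanSpace ℝ (Fin d) → ℝ)
    (hU : ContDiff ℝ 2 Ubar)
    (hζ : ContDiff ℝ 2 (fun q : EuclideanSpace ℝ (Fin d) × EuclideanSpace ℝ (Fin d) => ζ q.1 q.2))
    (hC : ContDiff ℝ 2 (fun q : EuclideanSpace ℝ (Fin m) × EuclideanSpace ℝ (Fin d) => C q.1 q.2))
    (M₁ : ℝ)
    (hHess : ∀ (ε : EuclideanSpace ℝ (Fin d)) (y : EuclideanSpace ℝ (Fin m))
      (z v : EuclideanSpace ℝ (Fin d)),
      ((fderiv ℝ (fderiv ℝ (fun w => (Ubar w + ζ ε w) - C y w)) z) v) v ≤ M₁ * ‖v‖ ^ 2)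
    (με : Measure (EuclideanSpace ℝ (Fin d))) [IsProbabilityMeasure με]
    (μy : Measure (EuclideanSpace ℝ (Fin m))) [IsProbabilityMeasure μy]
    (hac : με ≪ volume) (hμy : ∀ᵐ y ∂μy, y ∈ Y)
    -- Twist condition: `ε ↦ ∇_zζ(ε,z)` is injective for each `z`.
    (htwist : ∀ z : EuclideanSpace ℝ (Fin d),
      Function.Injective fun ε => fderiv ℝ (ζ ε) z)
    -- `z ↦ ∇_εζ(ε,z)` is injective on `Z` for each `ε`.
    (htwist' : ∀ ε : EuclideanSpace ℝ (Fin d),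
      Set.InjOn (fun z => fderiv ℝ (fun e => ζ e z) ε) Z)
    -- coercivity: `‖∇_zζ(ε,z)‖ → ∞` as `‖ε‖ → ∞`, uniformly in `z ∈ Z`.
    (hcoerc : ∀ M : ℝ, ∃ R : ℝ, ∀ ε : EuclideanSpace ℝ (Fin d), R ≤ ‖ε‖ →
      ∀ z ∈ Z, M ≤ ‖fderiv ℝ (ζ ε) z‖)
    (M₀ : ℝ)
    -- `D²_{εz}ζ(ε,z)` is invertible with inverse uniformly bounded by `M₀`.
    (hmix : ∀ (ε z : EuclideanSpace ℝ (Fin d)),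
      ∃ A : (EuclideanSpace ℝ (Fin d) →L[ℝ] ℝ) →L[ℝ] EuclideanSpace ℝ (Fin d),
        (∀ v, A ((fderiv ℝ (fun e => fderiv ℝ (ζ e) z) ε) v) = v) ∧
        (∀ w, (fderiv ℝ (fun e => fderiv ℝ (ζ e) z) ε) (A w) = w) ∧ ‖A‖ ≤ M₀)
    (γ : Measure (EuclideanSpace ℝ (Fin d) × EuclideanSpace ℝ (Fin d) × EuclideanSpace ℝ (Fin m)))
    (hγ : IsProbabilityMeasure γ)
    (hγε : γ.map (fun q => q.1) = με)
    (hγy : γ.map (fun q => q.2.2) = μy)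
    (heqm : ∀ᵐ q ∂γ, q.2.1 ∈ interior Z ∧
      IsMaxOn (fun z' => (Ubar z' + ζ q.1 z') - price z') Z q.2.1 ∧
      IsMaxOn (fun z' => price z' - C q.2.2 z') Z q.2.1)
    (hsel : ∃ sel : EuclideanSpace ℝ (Fin d) × EuclideanSpace ℝ (Fin m) → EuclideanSpace ℝ (Fin d),
      Measurable sel ∧ ∀ ε y, sel (ε, y) ∈ Z ∧
        IsMaxOn (fun z => (Ubar z + ζ ε z) - C y z) Z (sel (ε, y))) :
    γ.map (fun q => q.2.1) ≪ volume := by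
  have hu : ContDiff ℝ 2 (fun q : EuclideanSpace ℝ (Fin d) × EuclideanSpace ℝ (Fin d) =>
      Ubar q.2 + ζ q.1 q.2) := (hU.comp contDiff_snd).add hζ
  have hF : ContDiff ℝ 1 (fun q : EuclideanSpace ℝ (Fin d) × EuclideanSpace ℝ (Fin d) =>
      fderiv ℝ (fun w => Ubar w + ζ q.1 w) q.2) :=
    ContDiff.fderiv (m := 2)
      (f := fun (q : EuclideanSpace ℝ (Fin d) × EuclideanSpace ℝ (Fin d)) w => Ubar w + ζ q.1 w)
      (hu.comp ((contDiff_fst.comp contDiff_fst).prodMk contDiff_snd)) contDiff_snd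
      (by norm_num)
  have hζd : ∀ ε, Differentiable ℝ (ζ ε) := fun ε =>
    (hζ.comp (contDiff_const.prodMk contDiff_id)).differentiable (by norm_num)
  have hUd : Differentiable ℝ Ubar := hU.differentiable (by norm_num)
  have hpartial : ∀ ε z v,
      fderiv ℝ (fun q : EuclideanSpace ℝ (Fin d) × EuclideanSpace ℝ (Fin d) =>
        fderiv ℝ (fun w => Ubar w + ζ q.1 w) q.2) (ε, z) (v, 0) =
      fderiv ℝ (fun e => fderiv ℝ (ζ e) z) ε v := by
    intro ε z v
    have h1 : HasFDerivAt (fun e => fderiv ℝ (fun w => Ubar w + ζ e w) z)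
        ((fderiv ℝ (fun q : EuclideanSpace ℝ (Fin d) × EuclideanSpace ℝ (Fin d) =>
          fderiv ℝ (fun w => Ubar w + ζ q.1 w) q.2) (ε, z)).comp
          (ContinuousLinearMap.inl ℝ _ _)) ε :=
      HasFDerivAt.comp (g := fun q : EuclideanSpace ℝ (Fin d) × EuclideanSpace ℝ (Fin d) =>
        fderiv ℝ (fun w => Ubar w + ζ q.1 w) q.2) (f := fun e => (e, z)) ε
        ((hF.differentiable one_ne_zero (ε, z)).hasFDerivAt)
        (hasFDerivAt_prodMk_left ε z)
    have h2 : (fun e => fderiv ℝ (fun w => Ubar w + ζ e w) z) =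
        fun e => fderiv ℝ Ubar z + fderiv ℝ (ζ e) z :=
      funext fun e => fderiv_fun_add (hUd z) (hζd e z)
    have h3 := h1.fderiv
    rw [h2, fderiv_const_add] at h3
    rw [h3]
    rfl
  refine Measure.AbsolutelyContinuous.mk fun N hN hN0 => ?_
  rw [Measure.map_apply (by fun_prop) hN]
  let S : Set (EuclideanSpace ℝ (Fin d) × EuclideanSpace ℝ (Fin d) × EuclideanSpace ℝ (Fin m)) :=
    {q | q.2.1 ∈ interior Z ∧
      IsMaxOn (fun z' => (Ubar z' + ζ q.1 z') - price z') Z q.2.1 ∧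
      IsMaxOn (fun z' => price z' - C q.2.2 z') Z q.2.1}
  have hlocal : γ (S ∩ (fun q => q.2.1) ⁻¹' N) = 0 := by
    refine measure_null_of_locally_null _ fun q₀ hq₀ => ?_
    obtain ⟨K, hK, V, hV, hVS⟩ := exists_ball_norm_fderiv_sub_le
      (u := fun ε w => Ubar w + ζ ε w) (k := C) (p := price) (Z := Z) (S := S) hu hC
      (fun q hq => hq) hq₀.1
    obtain ⟨A, hA, -, -⟩ := hmix q₀.1 q₀.2.1
    obtain ⟨c, hc, W, hW, hWc⟩ := HasStrictFDerivAt.exists_norm_fst_sub_le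
      (hF.contDiffAt.hasStrictFDerivAt (x := (q₀.1, q₀.2.1)) one_ne_zero) A
      (fun v => by rw [hpartial, hA])
    have hcont : ContinuousAt (fun q : EuclideanSpace ℝ (Fin d) × EuclideanSpace ℝ (Fin d) ×
        EuclideanSpace ℝ (Fin m) => (q.1, q.2.1)) q₀ := by fun_prop
    refine ⟨(V ∩ (fun q => (q.1, q.2.1)) ⁻¹' W) ∩ (S ∩ (fun q => q.2.1) ⁻¹' N),
      inter_mem (mem_nhdsWithin_of_mem_nhds (inter_mem hV (hcont.preimage_mem_nhds hW)))
        self_mem_nhdsWithin, ?_⟩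
    have hvol : volume ((fun q => q.1) ''
        ((V ∩ (fun q => (q.1, q.2.1)) ⁻¹' W) ∩ (S ∩ (fun q => q.2.1) ⁻¹' N))) = 0 := by
      refine volume_image_eq_zero_of_lipschitz_relation (g := fun q => q.2.1)
        (c := (c * (K + 1)).toNNReal) (fun a ha b hb => ?_)
        (measure_mono_null (by rintro _ ⟨q, hq, rfl⟩; exact hq.2.2) hN0)
      have h1 := hVS a ⟨ha.1.1, ha.2.1⟩ b ⟨hb.1.1, hb.2.1⟩
      have h2 := hWc _ ha.1.2 _ hb.1.2
      rw [dist_eq_norm, dist_eq_norm]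
      refine h2.trans ((mul_le_mul_of_nonneg_left (add_le_add_left h1 _) hc).trans_eq ?_)
      rw [Real.coe_toNNReal _ (by positivity)]
      ring
    rw [← hγε] at hac
    exact measure_mono_null (subset_preimage_image _ _)
      (Measure.preimage_null_of_map_null (by fun_prop) (hac hvol))
  refine measure_mono_null (t := Sᶜ ∪ (S ∩ (fun q => q.2.1) ⁻¹' N)) (fun q hq => ?_)
    (measure_union_null heqm hlocal)
  by_cases hqS : q ∈ S
  exacts [Or.inr ⟨hqS, hq⟩, Or.inl hqS]
end

section
/- Suppose the two-sided hedonic equilibrium condition holds, that Ū, ζ and C are twice continuously differentiable, that ε ↦ ∇_zζ(ε,z) is injective on the support of μ_ε for each z ∈ Z (Twist condition), that ‖∇_zζ(ε,z)‖ → ∞ as ‖ε‖ → ∞ uniformly in z ∈ Z, and that the potential V(z) = p(z) − Ū(z) is ζ-convex. Then the marginal utility is nonparametrically identified: if Ū' is any continuously differentiable function on Z compatible with the data (μ_ε, μ_z, p) whose potential p − Ū' is ζ-convex, then ∇Ū'(z) = ∇Ū(z) for μ_z-almost every z. -/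
open MeasureTheory Set

/-- Topological support of a Borel measure: points all of whose neighborhoods have
positive measure. -/
def msupport {α : Type*} [TopologicalSpace α] [MeasurableSpace α]
    (μ : Measure α) : Set α :=
  {x | ∀ U ∈ nhds x, μ U ≠ 0}

/-- ζ-conjugate of `W : Z → ℝ`: `W^ζ(ε) = sup_{z ∈ Z} (ζ(ε,z) - W z)`. -/
noncomputable def zetaConj {d : ℕ} (Z : Set (EuclideanSpace ℝ (Fin d)))
    (ζ : EuclideanSpace ℝ (Fin d) → EuclideanSpace ℝ (Fin d) → ℝ)
    (W : EuclideanSpace ℝ (Fin d) → ℝ) (ε : EuclideanSpace ℝ (Fin d)) : ℝ :=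
  sSup ((fun z => ζ ε z - W z) '' Z)

/-- ζ-double-conjugate: `W^{ζζ}(z) = sup_{ε ∈ ℝ^d} (ζ(ε,z) - W^ζ(ε))`. -/
noncomputable def zetaConj2 {d : ℕ} (Z : Set (EuclideanSpace ℝ (Fin d)))
    (ζ : EuclideanSpace ℝ (Fin d) → EuclideanSpace ℝ (Fin d) → ℝ)
    (W : EuclideanSpace ℝ (Fin d) → ℝ) (z : EuclideanSpace ℝ (Fin d)) : ℝ :=
  ⨆ ε : EuclideanSpace ℝ (Fin d), (ζ ε z - zetaConj Z ζ W ε)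

/-- A function `W : Z → ℝ` is ζ-convex if it agrees with its ζ-double-conjugate on `Z`. -/
def ZetaConvexOn {d : ℕ} (Z : Set (EuclideanSpace ℝ (Fin d)))
    (ζ : EuclideanSpace ℝ (Fin d) → EuclideanSpace ℝ (Fin d) → ℝ)
    (W : EuclideanSpace ℝ (Fin d) → ℝ) : Prop :=
  ∀ z ∈ Z, W z = zetaConj2 Z ζ W z

/-- A candidate deterministic utility `W` is *compatible* with the single-market data
`(με, μz, price)` for the surplus `ζ`. -/
def CompatibleZ {d : ℕ} (Z : Set (EuclideanSpace ℝ (Fin d)))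
    (ζ : EuclideanSpace ℝ (Fin d) → EuclideanSpace ℝ (Fin d) → ℝ)
    (price : EuclideanSpace ℝ (Fin d) → ℝ)
    (με μz : Measure (EuclideanSpace ℝ (Fin d)))
    (W : EuclideanSpace ℝ (Fin d) → ℝ) : Prop :=
  ∃ γ : Measure (EuclideanSpace ℝ (Fin d) × EuclideanSpace ℝ (Fin d)),
    IsProbabilityMeasure γ ∧
    γ.map Prod.fst = με ∧ γ.map Prod.snd = μz ∧
    ∀ᵐ q ∂γ, q.2 ∈ interior Z ∧
      IsMaxOn (fun z' => W z' + ζ q.1 z' - price z') Z q.2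

section Conjugate

variable {d : ℕ} {Z : Set (EuclideanSpace ℝ (Fin d))}
  {ζ : EuclideanSpace ℝ (Fin d) → EuclideanSpace ℝ (Fin d) → ℝ}
  {W W' : EuclideanSpace ℝ (Fin d) → ℝ} {ε z : EuclideanSpace ℝ (Fin d)}

theorem zetaConj_eq_of_isMaxOn (hz : z ∈ Z) (h : IsMaxOn (fun z' => ζ ε z' - W z') Z z) :
    zetaConj Z ζ W ε = ζ ε z - W z :=
  IsGreatest.csSup_eq ⟨⟨z, hz, rfl⟩, by rintro _ ⟨z', hz', rfl⟩; exact h hz'⟩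

theorem le_zetaConj (hb : BddAbove ((fun z => ζ ε z - W z) '' Z)) (hz : z ∈ Z) :
    ζ ε z - W z ≤ zetaConj Z ζ W ε :=
  le_csSup hb ⟨z, hz, rfl⟩

theorem bddAbove_image_zeta_sub (hZc : IsCompact Z) (hζ : Continuous (ζ ε))
    (hW : BddBelow (W '' Z)) : BddAbove ((fun z => ζ ε z - W z) '' Z) := by
  obtain ⟨a, ha⟩ := hZc.bddAbove_image hζ.continuousOn
  obtain ⟨b, hb⟩ := hW
  refine ⟨a - b, ?_⟩
  rintro _ ⟨z, hz, rfl⟩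
  exact sub_le_sub (ha ⟨z, hz, rfl⟩) (hb ⟨z, hz, rfl⟩)

/-- The potential is bounded below as soon as some taste attains its maximum against it. -/
theorem bddBelow_image_of_isMaxOn (hZc : IsCompact Z) (hζ : Continuous (ζ ε))
    (h : IsMaxOn (fun z' => ζ ε z' - W z') Z z) : BddBelow (W '' Z) := by
  obtain ⟨a, ha⟩ := hZc.bddBelow_image hζ.continuousOn
  refine ⟨a - (ζ ε z - W z), ?_⟩
  rintro _ ⟨z', hz', rfl⟩
  have h1 : ζ ε z' - W z' ≤ ζ ε z - W z := h hz'
  have h2 : a ≤ ζ ε z' := ha ⟨z', hz', rfl⟩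
  linarith

theorem measurable_zetaConj (hZc : IsCompact Z) (hζ : Continuous (Function.uncurry ζ))
    (hW : BddBelow (W '' Z)) : Measurable (zetaConj Z ζ W) := by
  have heq : zetaConj Z ζ W = fun ε => ⨆ z : Z, (ζ ε z - W z) := by
    funext ε
    exact sSup_image'
  rw [heq]
  refine LowerSemicontinuous.measurable (lowerSemicontinuous_ciSup (fun ε => ?_) fun z => ?_)
  · have := bddAbove_image_zeta_sub hZc (hζ.uncurry_left ε) hW
    rwa [image_eq_range] at this
  · exact ((hζ.uncurry_right (z : EuclideanSpace ℝ (Fin d))).sub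
      continuous_const).lowerSemicontinuous

theorem zetaConj_le_zetaConj_add (hne : Z.Nonempty) {K : ℝ}
    (hb : BddAbove ((fun z => ζ ε z - W' z) '' Z)) (hK : ∀ z ∈ Z, W' z - W z ≤ K) :
    zetaConj Z ζ W ε ≤ zetaConj Z ζ W' ε + K := by
  refine csSup_le (hne.image _) ?_
  rintro _ ⟨z, hz, rfl⟩
  have h1 := le_zetaConj hb hz
  have h2 := hK z hz
  show ζ ε z - W z ≤ _
  linarith

end Conjugate

/-- If two couplings with the same marginals are concentrated on opposite sides of the
hyperplane `f(x) + g(y) = 0`, both are concentrated on it. -/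
theorem ae_add_eq_zero_of_map_eq {Ω Ω' α β : Type*} [MeasurableSpace Ω] [MeasurableSpace Ω']
    [MeasurableSpace α] [MeasurableSpace β] {P : Measure Ω} {P' : Measure Ω'}
    [IsProbabilityMeasure P] [IsProbabilityMeasure P']
    {X : Ω → α} {S : Ω → β} {X' : Ω' → α} {S' : Ω' → β}
    (hX : Measurable X) (hS : Measurable S) (hX' : Measurable X') (hS' : Measurable S')
    (hXX' : P'.map X' = P.map X) (hSS' : P'.map S' = P.map S)
    {f : α → ℝ} {g : β → ℝ} (hf : Measurable f) (hg : Measurable g) {K : ℝ}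
    (hfK : ∀ x, |f x| ≤ K) (hgK : ∀ y, |g y| ≤ K)
    (hle : ∀ᵐ ω ∂P, f (X ω) + g (S ω) ≤ 0) (hge : ∀ᵐ ω ∂P', 0 ≤ f (X' ω) + g (S' ω)) :
    ∀ᵐ ω ∂P, f (X ω) + g (S ω) = 0 := by
  have i1 : Integrable (fun ω => f (X ω)) P :=
    .of_bound (hf.comp hX).aestronglyMeasurable K (.of_forall fun ω => hfK _)
  have i2 : Integrable (fun ω => g (S ω)) P :=
    .of_bound (hg.comp hS).aestronglyMeasurable K (.of_forall fun ω => hgK _)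
  have i1' : Integrable (fun ω => f (X' ω)) P' :=
    .of_bound (hf.comp hX').aestronglyMeasurable K (.of_forall fun ω => hfK _)
  have i2' : Integrable (fun ω => g (S' ω)) P' :=
    .of_bound (hg.comp hS').aestronglyMeasurable K (.of_forall fun ω => hgK _)
  have e1 : ∫ ω, f (X ω) ∂P = ∫ ω, f (X' ω) ∂P' := by
    rw [← integral_map hX.aemeasurable hf.aestronglyMeasurable,
      ← integral_map hX'.aemeasurable hf.aestronglyMeasurable, hXX']
  have e2 : ∫ ω, g (S ω) ∂P = ∫ ω, g (S' ω) ∂P' := by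
    rw [← integral_map hS.aemeasurable hg.aestronglyMeasurable,
      ← integral_map hS'.aemeasurable hg.aestronglyMeasurable, hSS']
  have h0 : 0 ≤ ∫ ω, (f (X ω) + g (S ω)) ∂P := by
    rw [integral_add i1 i2, e1, e2, ← integral_add i1' i2']
    exact integral_nonneg_of_ae hge
  have h1 : ∫ ω, -(f (X ω) + g (S ω)) ∂P = 0 := by
    rw [integral_neg]
    have := integral_nonpos_of_ae hle
    simp only [neg_eq_zero]
    exact le_antisymm this h0
  have hnn : 0 ≤ᵐ[P] fun ω => -(f (X ω) + g (S ω)) := by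
    filter_upwards [hle] with ω hω
    exact neg_nonneg.2 hω
  filter_upwards [(integral_eq_zero_iff_of_nonneg_ae hnn (i1.add i2).neg).1 h1] with ω hω
  exact neg_eq_zero.1 hω

/-- First-order condition: if `u` and `v` both admit an interior maximum at `z` after the same
differentiable perturbation, their derivatives at `z` agree. -/
theorem fderiv_eq_of_isLocalMax_add {E : Type*} [NormedAddCommGroup E] [NormedSpace ℝ E]
    {u v w : E → ℝ} {z : E} (hu : DifferentiableAt ℝ u z) (hv : DifferentiableAt ℝ v z)
    (hw : DifferentiableAt ℝ w z) (hmu : IsLocalMax (fun x => u x + w x) z)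
    (hmv : IsLocalMax (fun x => v x + w x) z) : fderiv ℝ u z = fderiv ℝ v z := by
  have h1 := hmu.fderiv_eq_zero
  have h2 := hmv.fderiv_eq_zero
  rw [fderiv_fun_add hu hw] at h1
  rw [fderiv_fun_add hv hw] at h2
  exact add_right_cancel (h1.trans h2.symm)

/-- identification of preferences under the Twist condition and
ζ-convexity. Under the two-sided hedonic equilibrium condition, with twice continuously
differentiable `Ubar`, `ζ`, `C`, the Twist condition on the support of `με`, the coercivity
condition on `∇_zζ`, and a ζ-convex potential `price - Ubar`, any continuously
differentiable `Ubar'` compatible with the data whose potential `price - Ubar'` is ζ-convex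
satisfies `∇Ubar' = ∇Ubar`, `μz`-almost everywhere. -/
theorem stmt_9 {d m : ℕ}
    (Z : Set (EuclideanSpace ℝ (Fin d))) (hZc : IsCompact Z) (hZi : (interior Z).Nonempty)
    (Y : Set (EuclideanSpace ℝ (Fin m))) (hYc : IsCompact Y)
    (Ubar : EuclideanSpace ℝ (Fin d) → ℝ)
    (ζ : EuclideanSpace ℝ (Fin d) → EuclideanSpace ℝ (Fin d) → ℝ)
    (C : EuclideanSpace ℝ (Fin m) → EuclideanSpace ℝ (Fin d) → ℝ)
    (price : EuclideanSpace ℝ (Fin d) → ℝ)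
    (hU : ContDiff ℝ 2 Ubar)
    (hζ : ContDiff ℝ 2 (fun q : EuclideanSpace ℝ (Fin d) × EuclideanSpace ℝ (Fin d) => ζ q.1 q.2))
    (hC : ContDiff ℝ 2 (fun q : EuclideanSpace ℝ (Fin m) × EuclideanSpace ℝ (Fin d) => C q.1 q.2))
    (με : Measure (EuclideanSpace ℝ (Fin d))) [IsProbabilityMeasure με]
    (μy : Measure (EuclideanSpace ℝ (Fin m))) [IsProbabilityMeasure μy]
    (hμy : ∀ᵐ y ∂μy, y ∈ Y)
    -- Twist condition: `ε ↦ ∇_zζ(ε,z)` is injective on the support of `με`, for each `z ∈ Z`.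
    (htwist : ∀ z ∈ Z,
      Set.InjOn (fun ε => fderiv ℝ (ζ ε) z) (msupport με))
    -- coercivity: `‖∇_zζ(ε,z)‖ → ∞` as `‖ε‖ → ∞`, uniformly in `z ∈ Z`.
    (hcoerc : ∀ M : ℝ, ∃ R : ℝ, ∀ ε : EuclideanSpace ℝ (Fin d), R ≤ ‖ε‖ →
      ∀ z ∈ Z, M ≤ ‖fderiv ℝ (ζ ε) z‖)
    -- the potential `V = price - Ubar` is ζ-convex.
    (hVzconv : ZetaConvexOn Z ζ (fun z => price z - Ubar z))
    (γ : Measure (EuclideanSpace ℝ (Fin d) × EuclideanSpace ℝ (Fin d) × EuclideanSpace ℝ (Fin m)))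
    (hγ : IsProbabilityMeasure γ)
    (hγε : γ.map (fun q => q.1) = με)
    (hγy : γ.map (fun q => q.2.2) = μy)
    (heqm : ∀ᵐ q ∂γ, q.2.1 ∈ interior Z ∧
      IsMaxOn (fun z' => (Ubar z' + ζ q.1 z') - price z') Z q.2.1 ∧
      IsMaxOn (fun z' => price z' - C q.2.2 z') Z q.2.1)
    (hsel : ∃ sel : EuclideanSpace ℝ (Fin d) × EuclideanSpace ℝ (Fin m) → EuclideanSpace ℝ (Fin d),
      Measurable sel ∧ ∀ ε y, sel (ε, y) ∈ Z ∧
        IsMaxOn (fun z => (Ubar z + ζ ε z) - C y z) Z (sel (ε, y))) :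
    ∀ Ubar' : EuclideanSpace ℝ (Fin d) → ℝ, ContDiffOn ℝ 1 Ubar' Z →
      CompatibleZ Z ζ price με (γ.map (fun q => q.2.1)) Ubar' →
      ZetaConvexOn Z ζ (fun z => price z - Ubar' z) →
      ∀ᵐ z ∂(γ.map (fun q => q.2.1)), fderiv ℝ Ubar' z = fderiv ℝ Ubar z := by
  intro Ubar' hU' hcomp _
  obtain ⟨γ', hγ', hγ'ε, hγ'z, hmax'⟩ := hcomp
  have hζc : Continuous (Function.uncurry ζ) := hζ.continuous
  have hZne : Z.Nonempty := hZi.mono interior_subset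
  have hZm : MeasurableSet Z := hZc.isClosed.measurableSet
  let V : EuclideanSpace ℝ (Fin d) → ℝ := fun z => price z - Ubar z
  let V' : EuclideanSpace ℝ (Fin d) → ℝ := fun z => price z - Ubar' z
  have hmaxV : ∀ᵐ q ∂γ, IsMaxOn (fun z' => ζ q.1 z' - V z') Z q.2.1 := by
    filter_upwards [heqm] with q hq
    convert hq.2.1 using 2
    simp only [V]
    ring
  have hmaxV' : ∀ᵐ q ∂γ', IsMaxOn (fun z' => ζ q.1 z' - V' z') Z q.2 := by
    filter_upwards [hmax'] with q hq
    convert hq.2 using 2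
    simp only [V']
    ring
  have hVb : BddBelow (V '' Z) := by
    obtain ⟨q, hq⟩ := hmaxV.exists
    exact bddBelow_image_of_isMaxOn hZc (hζc.uncurry_left q.1) hq
  have hV'b : BddBelow (V' '' Z) := by
    obtain ⟨q, hq⟩ := hmaxV'.exists
    exact bddBelow_image_of_isMaxOn hZc (hζc.uncurry_left q.1) hq
  have hbdd := fun ε => bddAbove_image_zeta_sub hZc (hζc.uncurry_left ε) hVb
  have hbdd' := fun ε => bddAbove_image_zeta_sub hZc (hζc.uncurry_left ε) hV'b
  have hdc : ContinuousOn (fun z => Ubar' z - Ubar z) Z :=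
    hU'.continuousOn.sub hU.continuous.continuousOn
  obtain ⟨K, hK⟩ := hZc.exists_bound_of_continuousOn hdc
  have hK0 : 0 ≤ K := (norm_nonneg _).trans (hK _ hZne.some_mem)
  classical
  let f : EuclideanSpace ℝ (Fin d) → ℝ := Z.piecewise (fun z => Ubar' z - Ubar z) fun _ => 0
  let g : EuclideanSpace ℝ (Fin d) → ℝ := fun ε => zetaConj Z ζ V ε - zetaConj Z ζ V' ε
  have hfZ : ∀ z ∈ Z, f z = V z - V' z := fun z hz => by
    simp only [f, V, V', piecewise_eq_of_mem _ _ _ hz]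
    ring
  have hf : Measurable f := hdc.measurable_piecewise continuousOn_const hZm
  have hg : Measurable g := (measurable_zetaConj hZc hζc hVb).sub (measurable_zetaConj hZc hζc hV'b)
  have hfK : ∀ z, |f z| ≤ K := fun z => by
    by_cases hz : z ∈ Z
    · simpa only [f, piecewise_eq_of_mem _ _ _ hz, Real.norm_eq_abs] using hK z hz
    · simpa only [f, piecewise_eq_of_notMem _ _ _ hz, abs_zero] using hK0
  have hgK : ∀ ε, |g ε| ≤ K := fun ε => by
    have h1 := zetaConj_le_zetaConj_add hZne (hbdd' ε) (W := V) (K := K) fun z hz => by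
      have := (abs_le.1 (hfK z)).1
      rw [hfZ z hz] at this
      linarith
    have h2 := zetaConj_le_zetaConj_add hZne (hbdd ε) (W := V') (K := K) fun z hz => by
      have := (abs_le.1 (hfK z)).2
      rwa [hfZ z hz] at this
    simp only [g, abs_le]
    constructor <;> linarith
  have hms : Measurable fun q : EuclideanSpace ℝ (Fin d) × EuclideanSpace ℝ (Fin d) ×
      EuclideanSpace ℝ (Fin m) => q.2.1 := measurable_fst.comp measurable_snd
  have hzero : ∀ᵐ q ∂γ, f q.2.1 + g q.1 = 0 := by
    refine ae_add_eq_zero_of_map_eq hms measurable_fst measurable_snd measurable_fst hγ'z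
      (hγ'ε.trans hγε.symm) hf hg hfK hgK ?_ ?_
    · filter_upwards [heqm, hmaxV] with q hq hm
      have hz := interior_subset hq.1
      have h1 := zetaConj_eq_of_isMaxOn hz hm
      have h2 := le_zetaConj (hbdd' q.1) hz
      rw [hfZ _ hz]
      simp only [g]
      linarith
    · filter_upwards [hmax', hmaxV'] with q hq hm
      have hz := interior_subset hq.1
      have h1 := zetaConj_eq_of_isMaxOn hz hm
      have h2 := le_zetaConj (hbdd q.1) hz
      rw [hfZ _ hz]
      simp only [g]
      linarith
  rw [ae_map_iff hms.aemeasurable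
    (measurableSet_eq_fun (measurable_fderiv ℝ Ubar') (measurable_fderiv ℝ Ubar))]
  filter_upwards [heqm, hmaxV, hzero] with q ⟨hqi, hqU, hqC⟩ hm h0
  have hz := interior_subset hqi
  have hZn : Z ∈ nhds q.2.1 := mem_interior_iff_mem_nhds.1 hqi
  have hζd : DifferentiableAt ℝ (ζ q.1) q.2.1 :=
    (hζ.comp (contDiff_const.prodMk contDiff_id)).differentiable two_ne_zero _
  have hCd : DifferentiableAt ℝ (C q.2.2) q.2.1 :=
    (hC.comp (contDiff_const.prodMk contDiff_id)).differentiable two_ne_zero _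
  refine fderiv_eq_of_isLocalMax_add ((hU'.contDiffAt hZn).differentiableAt one_ne_zero)
    (hU.differentiable two_ne_zero _) (hζd.sub hCd) ?_ ?_
  · filter_upwards [hZn] with z hzZ
    have h1 := zetaConj_eq_of_isMaxOn hz hm
    have h2 := le_zetaConj (hbdd' q.1) hzZ
    have h3 : price z - C q.2.2 z ≤ price q.2.1 - C q.2.2 q.2.1 := hqC hzZ
    rw [hfZ _ hz] at h0
    simp only [g, V, V', Pi.sub_apply] at h0 h1 h2 ⊢
    linarith
  · filter_upwards [hZn] with z hzZ
    have h1 : Ubar z + ζ q.1 z - price z ≤ Ubar q.2.1 + ζ q.1 q.2.1 - price q.2.1 := hqU hzZ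
    have h3 : price z - C q.2.2 z ≤ price q.2.1 - C q.2.2 q.2.1 := hqC hzZ
    simp only [Pi.sub_apply]
    linarith
end

section
/- (Purity of equilibrium demand under the Twist condition.) Let Z ⊂ ℝ^d, let ζ : ℝ^d × Z → ℝ be differentiable in z with ε ↦ ∇_zζ(ε,z) injective for each z ∈ Z, let Ū : Z → ℝ be differentiable, and let C(ỹ,·) : Z → ℝ be differentiable for each producer type ỹ. Define the maximized joint surplus S(ε,ỹ) := sup_{z∈Z}(Ū(z) + ζ(ε,z) − C(ỹ,z)), assumed finite. Suppose z̄ lies in the interior of Z and attains the supremum defining both S(ε₀,ỹ₀) and S(ε₁,ỹ₁), and that the 2-monotonicity inequality S(ε₀,ỹ₀) + S(ε₁,ỹ₁) ≥ S(ε₁,ỹ₀) + S(ε₀,ỹ₁) holds. Then ε₀ = ε₁. -/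
open Set

theorem IsMaxOn.csSup_image_eq {α : Type*} {f : α → ℝ} {s : Set α} {a : α}
    (h : IsMaxOn f s a) (ha : a ∈ s) : sSup (f '' s) = f a :=
  IsGreatest.csSup_eq ⟨mem_image_of_mem f ha, forall_mem_image.2 fun _ hx => h hx⟩

/-- First-order condition at an interior maximizer of `U + g - c`. -/
theorem IsMaxOn.fderiv_eq_of_add_sub {E : Type*} [NormedAddCommGroup E] [NormedSpace ℝ E]
    {U g c : E → ℝ} {s : Set E} {a : E} (h : IsMaxOn (fun z => U z + g z - c z) s a)
    (ha : a ∈ interior s) (hU : DifferentiableAt ℝ U a) (hg : DifferentiableAt ℝ g a)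
    (hc : DifferentiableAt ℝ c a) : fderiv ℝ g a = fderiv ℝ c a - fderiv ℝ U a := by
  have hzero : fderiv ℝ U a + fderiv ℝ g a - fderiv ℝ c a = 0 :=
    (h.isLocalMax (mem_interior_iff_mem_nhds.1 ha)).hasFDerivAt_eq_zero
      ((hU.hasFDerivAt.add hg.hasFDerivAt).sub hc.hasFDerivAt)
  rw [eq_sub_iff_add_eq', ← sub_eq_zero, hzero]

/-- purity of equilibrium demand under the Twist condition.
If `ζ` is differentiable in `z` with `ε ↦ ∇_zζ(ε,z)` injective for each `z ∈ Z`, `Ubar` and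
`C(y,·)` are differentiable, the maximized joint surpluses are finite, `zbar` is an interior
point of `Z` attaining the suprema defining both `S(ε₀,y₀)` and `S(ε₁,y₁)`, and the
2-monotonicity inequality `S(ε₀,y₀) + S(ε₁,y₁) ≥ S(ε₁,y₀) + S(ε₀,y₁)` holds, then
`ε₀ = ε₁`. -/
theorem stmt_12 {d : ℕ} {Ytype : Type*}
    (Z : Set (EuclideanSpace ℝ (Fin d)))
    (ζ : EuclideanSpace ℝ (Fin d) → EuclideanSpace ℝ (Fin d) → ℝ)
    (Ubar : EuclideanSpace ℝ (Fin d) → ℝ)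
    (C : Ytype → EuclideanSpace ℝ (Fin d) → ℝ)
    (hζdiff : ∀ ε : EuclideanSpace ℝ (Fin d), ∀ z ∈ Z, DifferentiableAt ℝ (ζ ε) z)
    (htwist : ∀ z ∈ Z, Function.Injective fun ε => fderiv ℝ (ζ ε) z)
    (hUdiff : ∀ z ∈ Z, DifferentiableAt ℝ Ubar z)
    (hCdiff : ∀ y : Ytype, ∀ z ∈ Z, DifferentiableAt ℝ (C y) z)
    -- the maximized joint surplus `S(ε,y) = sup_{z ∈ Z}(Ubar z + ζ ε z - C y z)` is finite
    (hfin : ∀ (ε : EuclideanSpace ℝ (Fin d)) (y : Ytype),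
      BddAbove ((fun z => Ubar z + ζ ε z - C y z) '' Z))
    (ε₀ ε₁ : EuclideanSpace ℝ (Fin d)) (y₀ y₁ : Ytype)
    (zbar : EuclideanSpace ℝ (Fin d)) (hz : zbar ∈ interior Z)
    (hmax₀ : IsMaxOn (fun z => Ubar z + ζ ε₀ z - C y₀ z) Z zbar)
    (hmax₁ : IsMaxOn (fun z => Ubar z + ζ ε₁ z - C y₁ z) Z zbar)
    (hmono : sSup ((fun z => Ubar z + ζ ε₁ z - C y₀ z) '' Z)
        + sSup ((fun z => Ubar z + ζ ε₀ z - C y₁ z) '' Z)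
      ≤ sSup ((fun z => Ubar z + ζ ε₀ z - C y₀ z) '' Z)
        + sSup ((fun z => Ubar z + ζ ε₁ z - C y₁ z) '' Z)) :
    ε₀ = ε₁ := by
  have hzZ := interior_subset hz
  rw [hmax₀.csSup_image_eq hzZ, hmax₁.csSup_image_eq hzZ] at hmono
  have hle : Ubar zbar + ζ ε₀ zbar - C y₁ zbar
      ≤ sSup ((fun z => Ubar z + ζ ε₀ z - C y₁ z) '' Z) :=
    le_csSup (hfin ε₀ y₁) ⟨zbar, hzZ, rfl⟩
  have hmax : IsMaxOn (fun z => Ubar z + ζ ε₁ z - C y₀ z) Z zbar := by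
    intro z hzmem
    have hlez : Ubar z + ζ ε₁ z - C y₀ z
        ≤ sSup ((fun z => Ubar z + ζ ε₁ z - C y₀ z) '' Z) :=
      le_csSup (hfin ε₁ y₀) ⟨z, hzmem, rfl⟩
    change Ubar z + ζ ε₁ z - C y₀ z ≤ Ubar zbar + ζ ε₁ zbar - C y₀ zbar
    linarith
  have hU := hUdiff zbar hzZ
  have hC := hCdiff y₀ zbar hzZ
  exact htwist zbar hzZ <|
    (hmax₀.fderiv_eq_of_add_sub hz hU (hζdiff ε₀ zbar hzZ) hC).trans
      (hmax.fderiv_eq_of_add_sub hz hU (hζdiff ε₁ zbar hzZ) hC).symm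
end

section
/- Let ψ : ℝ^d → ℝ be continuous and locally semiconvex, let x₀ ∈ ℝ^d, and let q be an extreme point of the subdifferential ∂ψ(x₀). Then there exists a sequence (xₙ) converging to x₀ such that ψ is differentiable at each xₙ and ∇ψ(xₙ) → q. -/
open Set Filter
open scoped RealInnerProductSpace Topology

/-- Subdifferential of `ψ : ℝ^d → ℝ` at `x₀`:
`∂ψ(x₀) = {q : ψ(x) - ψ(x₀) ≥ ⟪q, x - x₀⟫ + o(‖x - x₀‖) as x → x₀}`, expressed via the
liminf formulation: for every `c < 0`, eventually near `x₀`,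
`ψ x - ψ x₀ - ⟪q, x - x₀⟫ ≥ c‖x - x₀‖`. -/
def subdiff {d : ℕ} (ψ : EuclideanSpace ℝ (Fin d) → ℝ)
    (x₀ : EuclideanSpace ℝ (Fin d)) : Set (EuclideanSpace ℝ (Fin d)) :=
  {q | ∀ c : ℝ, c < 0 →
    ∀ᶠ x in 𝓝 x₀, c * ‖x - x₀‖ ≤ ψ x - ψ x₀ - ⟪q, x - x₀⟫}

/-- `ψ` is locally semiconvex: around every point there are `λ > 0` and an open ball on
which `x ↦ ψ x + λ‖x‖²` is convex. -/
def LocSemiconvex {d : ℕ} (ψ : EuclideanSpace ℝ (Fin d) → ℝ) : Prop :=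
  ∀ x₀ : EuclideanSpace ℝ (Fin d), ∃ lam : ℝ, 0 < lam ∧ ∃ r : ℝ, 0 < r ∧
    ConvexOn ℝ (Metric.ball x₀ r) (fun x => ψ x + lam * ‖x‖ ^ 2)

section ConvexHull

variable {E : Type*} [NormedAddCommGroup E] [NormedSpace ℝ E]

/-- The convex join of two compact sets is compact. -/
theorem IsCompact.isCompact_convexJoin {s t : Set E} (hs : IsCompact s) (ht : IsCompact t) :
    IsCompact (convexJoin ℝ s t) := by
  have himage : convexJoin ℝ s t =
      (fun p : ℝ × E × E => (1 - p.1) • p.2.1 + p.1 • p.2.2) '' (Icc (0 : ℝ) 1 ×ˢ s ×ˢ t) := by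
    ext x
    simp only [mem_convexJoin, segment_eq_image, mem_image, mem_prod, Prod.exists]
    constructor
    · rintro ⟨a, ha, b, hb, θ, hθ, rfl⟩
      exact ⟨θ, a, b, ⟨hθ, ha, hb⟩, rfl⟩
    · rintro ⟨θ, a, b, ⟨hθ, ha, hb⟩, rfl⟩
      exact ⟨a, ha, b, hb, θ, hθ, rfl⟩
  rw [himage]
  exact (isCompact_Icc.prod (hs.prod ht)).image (by fun_prop)

/-- Some compact set contains the convex hull of every subset of `s` with `k + 1` points, and is
contained in the convex hull of `s`. -/
theorem IsCompact.exists_isCompact_convexHull_finset_subset {s : Set E} (hs : IsCompact s) (k : ℕ) :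
    ∃ C : Set E, IsCompact C ∧ C ⊆ convexHull ℝ s ∧
      ∀ t : Finset E, (t : Set E) ⊆ s → t.card = k + 1 → convexHull ℝ (t : Set E) ⊆ C := by
  classical
  induction k with
  | zero =>
    refine ⟨s, hs, subset_convexHull ℝ s, fun t hts ht => ?_⟩
    obtain ⟨a, rfl⟩ := Finset.card_eq_one.1 ht
    simpa using hts
  | succ k ih =>
    obtain ⟨C, hC, hCs, hCt⟩ := ih
    refine ⟨convexJoin ℝ s C, hs.isCompact_convexJoin hC,
      convexJoin_subset (subset_convexHull ℝ s) hCs (convex_convexHull ℝ s), fun t hts ht => ?_⟩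
    obtain ⟨a, u, hau, rfl, hu⟩ := Finset.card_eq_succ.1 ht
    rw [Finset.coe_insert, insert_subset_iff] at hts
    have hune : (u : Set E).Nonempty := by
      rw [Finset.coe_nonempty, ← Finset.card_pos]
      omega
    rw [Finset.coe_insert, convexHull_insert hune]
    exact convexJoin_mono (singleton_subset_iff.2 hts.1) (hCt u hts.2 hu)

/-- In finite dimension the convex hull of a compact set is compact. -/
theorem IsCompact.isCompact_convexHull [FiniteDimensional ℝ E] {s : Set E} (hs : IsCompact s) :
    IsCompact (convexHull ℝ s) := by
  choose C hC hCs hCt using hs.exists_isCompact_convexHull_finset_subset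
  have hunion : convexHull ℝ s = ⋃ k ∈ Finset.range (Module.finrank ℝ E + 1), C k := by
    refine Subset.antisymm (fun x hx => ?_) (iUnion₂_subset fun k _ => hCs k)
    rw [convexHull_eq_union] at hx
    simp only [mem_iUnion] at hx
    obtain ⟨t, hts, hind, hxt⟩ := hx
    have hpos : 0 < t.card := by
      rw [Finset.card_pos, ← Finset.coe_nonempty, ← convexHull_nonempty_iff (𝕜 := ℝ)]
      exact ⟨x, hxt⟩
    have hcard := hind.card_le_finrank_succ
    rw [Fintype.card_coe] at hcard
    have hle := Submodule.finrank_le (vectorSpan ℝ (range ((↑) : t → E)))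
    refine mem_iUnion₂.2 ⟨t.card - 1, Finset.mem_range.2 (by omega), ?_⟩
    exact hCt _ t hts (by omega) hxt
  rw [hunion]
  exact (Finset.range _).isCompact_biUnion fun k _ => hC k

end ConvexHull

/-- A locally Lipschitz function on a finite-dimensional space is differentiable on a dense set. -/
theorem LocallyLipschitz.dense_differentiableAt {E : Type*} [NormedAddCommGroup E]
    [NormedSpace ℝ E] [FiniteDimensional ℝ E] {f : E → ℝ} (hf : LocallyLipschitz f) :
    Dense {x | DifferentiableAt ℝ f x} := by
  borelize E
  rw [dense_iff_inter_open]
  rintro U hU ⟨x, hx⟩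
  obtain ⟨K, t, ht, hK⟩ := hf x
  have hV : IsOpen (U ∩ interior t) := hU.inter isOpen_interior
  have hpos : MeasureTheory.Measure.addHaar (U ∩ interior t) ≠ 0 :=
    (hV.measure_pos _ ⟨x, hx, mem_interior_iff_mem_nhds.2 ht⟩).ne'
  have hae := hK.ae_differentiableWithinAt_of_mem (μ := MeasureTheory.Measure.addHaar)
  obtain ⟨y, ⟨hyU, hyt⟩, hy⟩ :=
    ((MeasureTheory.frequently_ae_mem_iff.2 hpos).and_eventually hae).exists
  exact ⟨y, hyU, (hy (interior_subset hyt)).differentiableAt (mem_interior_iff_mem_nhds.1 hyt)⟩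

section Semiconvex

variable {d : ℕ} {ψ : EuclideanSpace ℝ (Fin d) → ℝ}

theorem LocSemiconvex.locallyLipschitz (hsc : LocSemiconvex ψ) : LocallyLipschitz ψ := by
  intro x
  obtain ⟨lam, -, r, hr, hconv⟩ := hsc x
  obtain ⟨K, t, ht, hK⟩ :=
    hconv.locallyLipschitzOn Metric.isOpen_ball (Metric.mem_ball_self hr)
  rw [Metric.isOpen_ball.nhdsWithin_eq (Metric.mem_ball_self hr)] at ht
  have hquad : ContDiff ℝ 1 fun y : EuclideanSpace ℝ (Fin d) => lam * ‖y‖ ^ 2 :=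
    contDiff_const.mul (contDiff_norm_sq ℝ)
  obtain ⟨L, u, hu, hL⟩ := hquad.locallyLipschitz x
  refine ⟨K + L, t ∩ u, inter_mem ht hu, ?_⟩
  simpa using (hK.mono inter_subset_left).sub (hL.mono inter_subset_right)

/-- On a ball where `ψ + λ‖·‖²` is convex, a subgradient of `ψ` supports it from below on
the whole ball, up to a quadratic error. -/
theorem sub_mul_sq_le_of_mem_subdiff {lam r : ℝ} {z x y p : EuclideanSpace ℝ (Fin d)}
    (hconv : ConvexOn ℝ (Metric.ball z r) fun x => ψ x + lam * ‖x‖ ^ 2)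
    (hx : x ∈ Metric.ball z r) (hy : y ∈ Metric.ball z r) (hp : p ∈ subdiff ψ x) :
    ψ x + ⟪p, y - x⟫ - lam * ‖y - x‖ ^ 2 ≤ ψ y := by
  have hline : Tendsto (fun s : ℝ => x + s • (y - x)) (𝓝[>] 0) (𝓝 x) := by
    have : Continuous fun s : ℝ => x + s • (y - x) := by fun_prop
    simpa using (this.tendsto 0).mono_left nhdsWithin_le_nhds
  have hlower : ∀ c : ℝ, c < 0 →
      c * ‖y - x‖ ≤ ψ y - ψ x - ⟪p, y - x⟫ + lam * ‖y - x‖ ^ 2 := by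
    intro c hc
    have hlim : Tendsto (fun s : ℝ => ψ y - ψ x - ⟪p, y - x⟫ + lam * (1 - s) * ‖y - x‖ ^ 2)
        (𝓝[>] 0) (𝓝 (ψ y - ψ x - ⟪p, y - x⟫ + lam * ‖y - x‖ ^ 2)) := by
      have : Continuous fun s : ℝ =>
          ψ y - ψ x - ⟪p, y - x⟫ + lam * (1 - s) * ‖y - x‖ ^ 2 := by fun_prop
      simpa using (this.tendsto 0).mono_left nhdsWithin_le_nhds
    refine ge_of_tendsto hlim ?_
    filter_upwards [hline.eventually (hp c hc), Ioo_mem_nhdsGT (zero_lt_one' ℝ)] with s hs hs01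
    have hcomb := hconv.2 hx hy (sub_nonneg.2 hs01.2.le) hs01.1.le (sub_add_cancel 1 s)
    have hpoint : (1 - s) • x + s • y = x + s • (y - x) := by module
    have hnorm : ‖x + s • (y - x)‖ ^ 2
        = (1 - s) * ‖x‖ ^ 2 + s * ‖y‖ ^ 2 - s * (1 - s) * ‖y - x‖ ^ 2 := by
      rw [norm_add_sq_real, norm_smul, inner_smul_right, inner_sub_right,
        real_inner_self_eq_norm_sq, norm_sub_sq_real, mul_pow, norm_sub_sq_real,
        Real.norm_eq_abs, sq_abs, real_inner_comm x y]
      ring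
    rw [hpoint] at hcomb
    simp only [smul_eq_mul, hnorm] at hcomb
    rw [add_sub_cancel_left, norm_smul, inner_smul_right, Real.norm_eq_abs,
      abs_of_pos hs01.1] at hs
    refine le_of_mul_le_mul_left ?_ hs01.1
    linarith
  have hlim : Tendsto (fun c : ℝ => c * ‖y - x‖) (𝓝[<] 0) (𝓝 0) := by
    have : Continuous fun c : ℝ => c * ‖y - x‖ := by fun_prop
    simpa using (this.tendsto 0).mono_left nhdsWithin_le_nhds
  have := le_of_tendsto hlim (eventually_mem_nhdsWithin.mono hlower)
  linarith

theorem mem_subdiff_of_eventually_sub_mul_sq_le {lam : ℝ} (hlam : 0 < lam)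
    {x p : EuclideanSpace ℝ (Fin d)}
    (h : ∀ᶠ y in 𝓝 x, ψ x + ⟪p, y - x⟫ - lam * ‖y - x‖ ^ 2 ≤ ψ y) : p ∈ subdiff ψ x := by
  intro c hc
  filter_upwards [h, Metric.ball_mem_nhds x (div_pos (neg_pos.2 hc) hlam)] with y hy hball
  rw [mem_ball_iff_norm, lt_div_iff₀ hlam] at hball
  nlinarith [norm_nonneg (y - x)]

theorem HasGradientAt.mem_subdiff {x p : EuclideanSpace ℝ (Fin d)} (h : HasGradientAt ψ p x) :
    p ∈ subdiff ψ x := by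
  intro c hc
  filter_upwards [(hasGradientAt_iff_isLittleO.1 h).bound (neg_pos.2 hc)] with y hy
  rw [Real.norm_eq_abs] at hy
  linarith [neg_le_of_abs_le hy]

theorem HasGradientAt.norm_le_of_lipschitzOn {E : Type*} [NormedAddCommGroup E]
    [InnerProductSpace ℝ E] [CompleteSpace E] {f : E → ℝ} {x p : E} {s : Set E} {K : NNReal}
    (h : HasGradientAt f p x) (hs : s ∈ 𝓝 x) (hK : LipschitzOnWith K f s) : ‖p‖ ≤ K := by
  simpa using h.hasFDerivAt.le_of_lipschitzOn hs hK

/-- The limits of gradients of `ψ` along sequences of points converging to `x₀`. -/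
def limitingGradients (ψ : EuclideanSpace ℝ (Fin d) → ℝ) (x₀ : EuclideanSpace ℝ (Fin d)) :
    Set (EuclideanSpace ℝ (Fin d)) :=
  {p | (x₀, p) ∈ closure {z : EuclideanSpace ℝ (Fin d) × EuclideanSpace ℝ (Fin d) |
    HasGradientAt ψ z.2 z.1}}

theorem mem_limitingGradients_iff {x₀ p : EuclideanSpace ℝ (Fin d)} :
    p ∈ limitingGradients ψ x₀ ↔ ∃ x g : ℕ → EuclideanSpace ℝ (Fin d),
      Tendsto x atTop (𝓝 x₀) ∧ (∀ n, HasGradientAt ψ (g n) (x n)) ∧ Tendsto g atTop (𝓝 p) := by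
  rw [limitingGradients, mem_ofPred_eq, mem_closure_iff_seq_limit]
  constructor
  · rintro ⟨z, hz, hlim⟩
    exact ⟨fun n => (z n).1, fun n => (z n).2, hlim.fst_nhds, hz, hlim.snd_nhds⟩
  · rintro ⟨x, g, hx, hg, hp⟩
    exact ⟨fun n => (x n, g n), hg, hx.prodMk_nhds hp⟩

theorem LocallyLipschitz.isCompact_limitingGradients (hψ : LocallyLipschitz ψ)
    (x₀ : EuclideanSpace ℝ (Fin d)) : IsCompact (limitingGradients ψ x₀) := by
  obtain ⟨K, t, ht, hK⟩ := hψ x₀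
  refine (isCompact_closedBall (0 : EuclideanSpace ℝ (Fin d)) K).of_isClosed_subset
    (isClosed_closure.preimage (by fun_prop)) fun p hp => ?_
  obtain ⟨x, g, hx, hg, hp⟩ := mem_limitingGradients_iff.1 hp
  rw [mem_closedBall_zero_iff]
  refine le_of_tendsto hp.norm ?_
  filter_upwards [hx.eventually (eventually_mem_nhds_iff.2 ht)] with n hn
  exact (hg n).norm_le_of_lipschitzOn hn hK

theorem LocSemiconvex.limitingGradients_subset_subdiff (hsc : LocSemiconvex ψ)
    (x₀ : EuclideanSpace ℝ (Fin d)) : limitingGradients ψ x₀ ⊆ subdiff ψ x₀ := by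
  intro p hp
  obtain ⟨x, g, hx, hg, hp⟩ := mem_limitingGradients_iff.1 hp
  obtain ⟨lam, hlam, r, hr, hconv⟩ := hsc x₀
  have hψx := (hsc.locallyLipschitz.continuous.tendsto x₀).comp hx
  refine mem_subdiff_of_eventually_sub_mul_sq_le hlam ?_
  filter_upwards [Metric.ball_mem_nhds x₀ hr] with y hy
  have hdiff : Tendsto (fun n => y - x n) atTop (𝓝 (y - x₀)) := tendsto_const_nhds.sub hx
  refine le_of_tendsto ((hψx.add (hp.inner hdiff)).sub ((hdiff.norm.pow 2).const_mul lam)) ?_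
  filter_upwards [hx.eventually (Metric.ball_mem_nhds x₀ hr)] with n hn
  exact sub_mul_sq_le_of_mem_subdiff hconv hn hy (hg n).mem_subdiff

/-- In every direction `v`, some limiting gradient at `x₀` dominates a given subgradient. -/
theorem LocSemiconvex.exists_limitingGradient_inner_le (hsc : LocSemiconvex ψ)
    {x₀ q : EuclideanSpace ℝ (Fin d)} (hq : q ∈ subdiff ψ x₀) (v : EuclideanSpace ℝ (Fin d)) :
    ∃ p ∈ limitingGradients ψ x₀, ⟪q, v⟫ ≤ ⟪p, v⟫ := by
  obtain ⟨lam, hlam, r, hr, hconv⟩ := hsc x₀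
  have hlip := hsc.locallyLipschitz
  obtain ⟨K, t, ht, hK⟩ := hlip x₀
  set τ : ℕ → ℝ := fun n => 1 / ((n : ℝ) + 1) with hτ
  have hτpos : ∀ n, 0 < τ n := fun n => Nat.one_div_pos_of_nat
  have hτlim : Tendsto τ atTop (𝓝 0) := tendsto_one_div_add_atTop_nhds_zero_nat
  have hex : ∀ n, ∃ w : EuclideanSpace ℝ (Fin d),
      ‖w - v‖ < τ n ∧ DifferentiableAt ℝ ψ (x₀ + τ n • w) := by
    intro n
    obtain ⟨y, hydiff, hy⟩ := hlip.dense_differentiableAt.exists_dist_lt (x₀ + τ n • v)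
      (mul_pos (hτpos n) (hτpos n))
    refine ⟨(τ n)⁻¹ • (y - x₀), ?_, ?_⟩
    · have hw : y - (x₀ + τ n • v) = τ n • ((τ n)⁻¹ • (y - x₀) - v) := by
        rw [smul_sub, smul_inv_smul₀ (hτpos n).ne']
        abel
      rw [dist_comm, dist_eq_norm, hw, norm_smul, Real.norm_eq_abs, abs_of_pos (hτpos n)] at hy
      exact lt_of_mul_lt_mul_left hy (hτpos n).le
    · rw [smul_inv_smul₀ (hτpos n).ne', add_sub_cancel]
      exact hydiff
  choose w hwv hwdiff using hex
  have hwlim : Tendsto w atTop (𝓝 v) :=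
    tendsto_iff_norm_sub_tendsto_zero.2
      (squeeze_zero (fun _ => norm_nonneg _) (fun n => (hwv n).le) hτlim)
  have hxlim : Tendsto (fun n => x₀ + τ n • w n) atTop (𝓝 x₀) := by
    simpa using tendsto_const_nhds.add (hτlim.smul hwlim)
  have hgrad := fun n => (hwdiff n).hasGradientAt
  set g : ℕ → EuclideanSpace ℝ (Fin d) := fun n => gradient ψ (x₀ + τ n • w n)
  have hbound : ∃ᶠ n in atTop, g n ∈ Metric.closedBall (0 : EuclideanSpace ℝ (Fin d)) K := by
    refine Eventually.frequently ?_
    filter_upwards [hxlim.eventually (eventually_mem_nhds_iff.2 ht)] with n hn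
    exact mem_closedBall_zero_iff.2 ((hgrad n).norm_le_of_lipschitzOn hn hK)
  obtain ⟨p, -, φ, hφ, hp⟩ :=
    (isCompact_closedBall (0 : EuclideanSpace ℝ (Fin d)) K).tendsto_subseq' hbound
  refine ⟨p, mem_limitingGradients_iff.2
    ⟨_, _, hxlim.comp hφ.tendsto_atTop, fun n => hgrad (φ n), hp⟩, ?_⟩
  have hmono : ∀ᶠ n in atTop, ⟪q, w n⟫ - 2 * lam * τ n * ‖w n‖ ^ 2 ≤ ⟪g n, w n⟫ := by
    filter_upwards [hxlim.eventually (Metric.ball_mem_nhds x₀ hr)] with n hn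
    have hq' := sub_mul_sq_le_of_mem_subdiff hconv (Metric.mem_ball_self hr) hn hq
    have hg' := sub_mul_sq_le_of_mem_subdiff hconv hn (Metric.mem_ball_self hr)
      (hgrad n).mem_subdiff
    rw [sub_add_cancel_left, inner_neg_right, norm_neg] at hg'
    rw [add_sub_cancel_left] at hq'
    rw [inner_smul_right, norm_smul, Real.norm_eq_abs, abs_of_pos (hτpos n)] at hq' hg'
    refine le_of_mul_le_mul_left ?_ (hτpos n)
    linarith
  have hleft : Tendsto (fun n => ⟪q, w n⟫ - 2 * lam * τ n * ‖w n‖ ^ 2) atTop (𝓝 ⟪q, v⟫) := by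
    simpa using ((tendsto_const_nhds (x := q)).inner hwlim).sub
      ((hτlim.const_mul (2 * lam)).mul (hwlim.norm.pow 2))
  exact le_of_tendsto_of_tendsto (hleft.comp hφ.tendsto_atTop)
    (hp.inner (hwlim.comp hφ.tendsto_atTop)) (hφ.tendsto_atTop.eventually hmono)

theorem LocSemiconvex.subdiff_subset_convexHull_limitingGradients (hsc : LocSemiconvex ψ)
    (x₀ : EuclideanSpace ℝ (Fin d)) :
    subdiff ψ x₀ ⊆ convexHull ℝ (limitingGradients ψ x₀) := by
  intro q hq
  by_contra hqK
  obtain ⟨l, u, hlu, hul⟩ := geometric_hahn_banach_closed_point (convex_convexHull ℝ _)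
    (hsc.locallyLipschitz.isCompact_limitingGradients x₀).isCompact_convexHull.isClosed hqK
  obtain ⟨p, hp, hqp⟩ := hsc.exists_limitingGradient_inner_le hq
    ((InnerProductSpace.toDual ℝ (EuclideanSpace ℝ (Fin d))).symm l)
  rw [real_inner_comm, real_inner_comm _ p, InnerProductSpace.toDual_symm_apply,
    InnerProductSpace.toDual_symm_apply] at hqp
  linarith [hlu p (subset_convexHull ℝ _ hp)]

/-- The subdifferential is convex. -/
theorem convex_subdiff (x₀ : EuclideanSpace ℝ (Fin d)) : Convex ℝ (subdiff ψ x₀) := by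
  intro p hp p' hp' a b ha hb hab c hc
  filter_upwards [hp c hc, hp' c hc] with y hy hy'
  rw [inner_add_left, real_inner_smul_left, real_inner_smul_left]
  obtain rfl : b = 1 - a := by linarith
  nlinarith

end Semiconvex

/-- extreme points of the subdifferential of a locally semiconvex function
are limits of nearby gradients. If `ψ` is continuous and locally semiconvex and `q` is an
extreme point of `∂ψ(x₀)`, then there is a sequence `xₙ → x₀` at which `ψ` is differentiable
with gradients `∇ψ(xₙ) → q`. -/
theorem stmt_14 {d : ℕ}
    (ψ : EuclideanSpace ℝ (Fin d) → ℝ)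
    (hcont : Continuous ψ) (hsc : LocSemiconvex ψ)
    (x₀ : EuclideanSpace ℝ (Fin d))
    (q : EuclideanSpace ℝ (Fin d))
    (hq : q ∈ Set.extremePoints ℝ (subdiff ψ x₀)) :
    ∃ (x : ℕ → EuclideanSpace ℝ (Fin d)) (g : ℕ → EuclideanSpace ℝ (Fin d)),
      Tendsto x atTop (𝓝 x₀) ∧
      (∀ n, HasGradientAt ψ (g n) (x n)) ∧
      Tendsto g atTop (𝓝 q) := by
  have hS : convexHull ℝ (limitingGradients ψ x₀) ⊆ subdiff ψ x₀ :=
    convexHull_min (hsc.limitingGradients_subset_subdiff x₀) (convex_subdiff x₀)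
  exact mem_limitingGradients_iff.1 (extremePoints_convexHull_subset
    (inter_extremePoints_subset_extremePoints_of_subset hS
      ⟨hsc.subdiff_subset_convexHull_limitingGradients x₀ hq.1, hq⟩))
end

section
/- (Equilibrium quality distribution solves the social planner's problem.) Let Z ⊂ ℝ^{d_z} be compact, let U : X̃ × Z → ℝ be bounded and upper semicontinuous, let C : Ỹ × Z → ℝ be bounded and lower semicontinuous, with the joint surplus U(x̃,z) − C(ỹ,z) finite everywhere and (x̃,ỹ) ↦ argmax_{z∈Z}(U(x̃,z) − C(ỹ,z)) admitting a measurable selection. Let (γ, p) be a hedonic equilibrium with consumer type distribution P_x̃, producer type distribution P_ỹ, and let P_z denote the z-marginal of γ. Then P_z maximizes ν ↦ T_U(P_x̃, ν) + T_{−C}(P_ỹ, ν) over all Borel probability measures ν on Z; that is, for every Borel probability measure ν on Z, T_U(P_x̃, ν) + T_{−C}(P_ỹ, ν) ≤ T_U(P_x̃, P_z) + T_{−C}(P_ỹ, P_z). -/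
open Set MeasureTheory

/-- Optimal transport value `T_S(μ,ν) = sup_π ∫ S dπ`, the supremum over probability
couplings `π` of `μ` and `ν`. -/
noncomputable def TS {α β : Type*} [MeasurableSpace α] [MeasurableSpace β]
    (S : α → β → ℝ) (μ : Measure α) (ν : Measure β) : ℝ :=
  sSup {r : ℝ | ∃ π : Measure (α × β), IsProbabilityMeasure π ∧
    π.map Prod.fst = μ ∧ π.map Prod.snd = ν ∧ r = ∫ q, S q.1 q.2 ∂π}

open scoped ProbabilityTheory in
/-- An arbitrary function of the first coordinate that is dominated by an integrable function is
dominated by an integrable function of the first coordinate with the same integral. -/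
theorem exists_integrable_fst_ge {α β : Type*} [MeasurableSpace α] [MeasurableSpace β]
    [StandardBorelSpace β] [Nonempty β] (ρ : Measure (α × β)) [IsFiniteMeasure ρ]
    (F : α × β → ℝ) (hF : Integrable F ρ) (φ : α → ℝ) (hφ : ∀ᵐ q ∂ρ, φ q.1 ≤ F q) :
    ∃ g : α → ℝ, Integrable g (ρ.map Prod.fst) ∧ (∀ᵐ a ∂(ρ.map Prod.fst), φ a ≤ g a) ∧
      ∫ a, g a ∂(ρ.map Prod.fst) = ∫ q, F q ∂ρ := by
  have hd : ρ.fst ⊗ₘ ρ.condKernel = ρ := ρ.disintegrate ρ.condKernel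
  have hF' : Integrable F (ρ.fst ⊗ₘ ρ.condKernel) := by rwa [hd]
  have hφ' : ∀ᵐ q ∂(ρ.fst ⊗ₘ ρ.condKernel), φ q.1 ≤ F q := by rwa [hd]
  refine ⟨fun a => ∫ b, F (a, b) ∂(ρ.condKernel a), hF.integral_condKernel, ?_, ?_⟩
  · have hi := ((Measure.integrable_compProd_iff hF'.aestronglyMeasurable).1 hF').1
    have hae := Measure.ae_ae_of_ae_compProd hφ'
    change ∀ᵐ a ∂ρ.fst, φ a ≤ ∫ b, F (a, b) ∂(ρ.condKernel a)
    filter_upwards [hae, hi] with a ha hia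
    calc φ a = ∫ _, φ a ∂(ρ.condKernel a) := by simp
      _ ≤ _ := integral_mono_ae (integrable_const _) hia ha
  · have := Measure.integral_compProd hF'
    rw [hd] at this
    exact this.symm

/-- A function that is upper semicontinuous and bounded on a product of sets is integrable for a
finite measure whose coordinates lie in these sets almost surely. -/
theorem integrable_of_upperSemicontinuousOn {α : Type*}
    [TopologicalSpace α] [MeasurableSpace α] [OpensMeasurableSpace α]
    (A : Set α) (f : α → ℝ) (M : ℝ) (hb : ∀ q ∈ A, |f q| ≤ M)
    (hf : UpperSemicontinuousOn f A) (μ : Measure α) [IsFiniteMeasure μ]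
    (hμ : ∀ᵐ q ∂μ, q ∈ A) : Integrable f μ := by
  obtain ⟨S, hS, hSm, hSA⟩ := Filter.Eventually.exists_measurable_mem hμ
  have hm : AEMeasurable f (μ.restrict S) := by
    refine aemeasurable_restrict_of_measurable_subtype hSm ?_
    exact (upperSemicontinuousOn_iff_restrict.2 (hf.mono hSA)).measurable
  rw [Measure.restrict_eq_self_of_ae_mem hS] at hm
  refine Integrable.of_bound hm.aestronglyMeasurable M ?_
  filter_upwards [hμ] with q hq using hb q hq

/-- Weak duality without measurability of the potentials `v`, `p` and `w`: a plan `γ` on which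
the potentials are tight does at least as well as any pair of couplings with matching `Z`-marginal
and the same outer marginals. -/
theorem integral_sub_integral_le_of_potentials {X Z Y : Type*}
    [MeasurableSpace X] [StandardBorelSpace X] [Nonempty X]
    [MeasurableSpace Z] [StandardBorelSpace Z] [Nonempty Z]
    [MeasurableSpace Y] [StandardBorelSpace Y] [Nonempty Y]
    (u : X → Z → ℝ) (c : Y → Z → ℝ) (v : X → ℝ) (p : Z → ℝ) (w : Y → ℝ)
    (γ : Measure (X × Z × Y)) (π₁ : Measure (X × Z)) (π₂ : Measure (Y × Z))
    [IsProbabilityMeasure γ] [IsProbabilityMeasure π₁] [IsProbabilityMeasure π₂]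
    (hfst : π₁.map Prod.fst = γ.map Prod.fst)
    (hsnd : π₂.map Prod.fst = γ.map (fun q => q.2.2))
    (hmid : π₁.map Prod.snd = π₂.map Prod.snd)
    (hγi : Integrable (fun q => u q.1 q.2.1 - c q.2.2 q.2.1) γ)
    (hu : Integrable (fun q => u q.1 q.2) π₁) (hc : Integrable (fun q => c q.1 q.2) π₂)
    (hγ : ∀ᵐ q ∂γ, v q.1 + w q.2.2 ≤ u q.1 q.2.1 - c q.2.2 q.2.1)
    (hπ₁ : ∀ᵐ q ∂π₁, u q.1 q.2 - p q.2 ≤ v q.1)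
    (hπ₂ : ∀ᵐ q ∂π₂, p q.2 - c q.1 q.2 ≤ w q.1)
    (K : ℝ) (hv : ∀ᵐ x ∂(γ.map Prod.fst), |v x| ≤ K) :
    ∫ q, u q.1 q.2 ∂π₁ - ∫ q, c q.1 q.2 ∂π₂ ≤ ∫ q, (u q.1 q.2.1 - c q.2.2 q.2.1) ∂γ := by
  set D : ℝ := ∫ q, (u q.1 q.2.1 - c q.2.2 q.2.1) ∂γ
    - (∫ q, u q.1 q.2 ∂π₁ - ∫ q, c q.1 q.2 ∂π₂) with hD
  have : IsProbabilityMeasure (γ.map Prod.fst) := Measure.isProbabilityMeasure_map (by fun_prop)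
  have key : ∀ n : ℕ, ∃ f : X → ℝ, Integrable f (γ.map Prod.fst) ∧
      (∀ᵐ x ∂(γ.map Prod.fst), v x ≤ f x) ∧ ∫ x, f x ∂(γ.map Prod.fst) = K + n * D := by
    intro n
    induction n with
    | zero =>
      refine ⟨fun _ => K, integrable_const _, ?_, by simp⟩
      filter_upwards [hv] with x hx using (abs_le.1 hx).2
    | succ n ih =>
      obtain ⟨f, hfi, hvf, hf⟩ := ih
      rw [← hfst] at hfi hvf
      have hfi₁ : Integrable (fun q : X × Z => f q.1) π₁ := hfi.comp_measurable measurable_fst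
      have hvf₁ := ae_of_ae_map measurable_fst.aemeasurable hvf
      have : IsProbabilityMeasure (π₁.map Prod.swap) :=
        Measure.isProbabilityMeasure_map (by fun_prop)
      obtain ⟨g, hgi, hpg, hg⟩ := exists_integrable_fst_ge (π₁.map Prod.swap)
        (fun q => f q.2 - u q.2 q.1)
        ((MeasurableEquiv.prodComm.measurableEmbedding.integrable_map_iff
          (g := fun q : Z × X => f q.2 - u q.2 q.1)).2 (hfi₁.sub hu)) (fun z => -p z)
        ((MeasurableEquiv.prodComm.measurableEmbedding.ae_map_iff
          (p := fun q : Z × X => -p q.1 ≤ f q.2 - u q.2 q.1)).2 (by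
            filter_upwards [hvf₁, hπ₁] with q h₁ h₂
            change -p q.2 ≤ f q.1 - u q.1 q.2
            linarith))
      have hmap : (π₁.map Prod.swap).map Prod.fst = π₂.map Prod.snd := by
        rw [Measure.map_map measurable_fst measurable_swap, ← hmid]
        rfl
      have hgint : ∫ q, (f q.2 - u q.2 q.1) ∂(π₁.map Prod.swap)
          = ∫ x, f x ∂(γ.map Prod.fst) - ∫ q, u q.1 q.2 ∂π₁ := by
        rw [← hfst, integral_map measurable_fst.aemeasurable hfi.aestronglyMeasurable,
          ← integral_sub hfi₁ hu]
        exact MeasurableEquiv.prodComm.measurableEmbedding.integral_map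
          (fun q : Z × X => f q.2 - u q.2 q.1)
      rw [hmap] at hgi hpg hg
      have hgi₂ : Integrable (fun q : Y × Z => g q.2) π₂ := hgi.comp_measurable measurable_snd
      have hpg₂ := ae_of_ae_map measurable_snd.aemeasurable hpg
      obtain ⟨h, hhi, hwh, hh⟩ := exists_integrable_fst_ge π₂
        (fun q => g q.2 + c q.1 q.2) (hgi₂.add hc) (fun y => -w y) (by
          filter_upwards [hpg₂, hπ₂] with q h₁ h₂
          linarith)
      rw [integral_add hgi₂ hc,
        ← integral_map (f := g) measurable_snd.aemeasurable hgi.aestronglyMeasurable] at hh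
      have hm : Measurable (fun q : X × Z × Y => q.2.2) := by fun_prop
      rw [hsnd] at hhi hwh hh
      have hhi₃ : Integrable (fun q : X × Z × Y => h q.2.2) γ := hhi.comp_measurable hm
      have hwh₃ := ae_of_ae_map hm.aemeasurable hwh
      obtain ⟨f', hfi', hvf', hf'⟩ := exists_integrable_fst_ge γ
        (fun q => (u q.1 q.2.1 - c q.2.2 q.2.1) + h q.2.2) (hγi.add hhi₃) v (by
          filter_upwards [hwh₃, hγ] with q h₁ h₂
          linarith)
      rw [integral_add hγi hhi₃,
        ← integral_map (f := h) hm.aemeasurable hhi.aestronglyMeasurable] at hf'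
      refine ⟨f', hfi', hvf', ?_⟩
      rw [hf', hh, hg, hgint, hf]
      push_cast
      ring
  have hbound : ∀ n : ℕ, -(2 * K) ≤ n * D := by
    intro n
    obtain ⟨f, hfi, hvf, hf⟩ := key n
    have : ∫ _, -K ∂(γ.map Prod.fst) ≤ ∫ x, f x ∂(γ.map Prod.fst) := by
      refine integral_mono_ae (integrable_const _) hfi ?_
      filter_upwards [hvf, hv] with x h₁ h₂
      exact (abs_le.1 h₂).1.trans h₁
    rw [hf] at this
    simp only [integral_const, probReal_univ, one_smul] at this
    linarith
  by_contra! hlt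
  have hDneg : 0 < -D := by rw [hD]; linarith
  obtain ⟨n, hn⟩ := exists_nat_gt ((2 * K) / -D)
  rw [div_lt_iff₀ hDneg] at hn
  linarith [hbound n]

/-- The integral of a bounded surplus against a coupling is at most the transport value. -/
theorem integral_le_TS {α β : Type*} [MeasurableSpace α] [MeasurableSpace β]
    (S : α → β → ℝ) (μ : Measure α) (ν : Measure β) (A : Set α) (B : Set β)
    (hμ : ∀ᵐ a ∂μ, a ∈ A) (hν : ∀ᵐ b ∂ν, b ∈ B)
    (M : ℝ) (hS : ∀ a ∈ A, ∀ b ∈ B, |S a b| ≤ M)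
    (π : Measure (α × β)) [IsProbabilityMeasure π]
    (h₁ : π.map Prod.fst = μ) (h₂ : π.map Prod.snd = ν) :
    ∫ q, S q.1 q.2 ∂π ≤ TS S μ ν := by
  refine le_csSup ⟨M, ?_⟩ ⟨π, inferInstance, h₁, h₂, rfl⟩
  rintro r ⟨ρ, hρ, rfl, rfl, rfl⟩
  have h : ‖∫ q, S q.1 q.2 ∂ρ‖ ≤ M * ρ.real univ := by
    refine norm_integral_le_of_norm_le_const ?_
    filter_upwards [ae_of_ae_map measurable_fst.aemeasurable hμ,
      ae_of_ae_map measurable_snd.aemeasurable hν] with q ha hb using hS _ ha _ hb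
  simpa using (le_abs_self _).trans h

/-- A bound for the integrals against all couplings of `μ` and `ν` bounds the transport value. -/
theorem TS_le {α β : Type*} [MeasurableSpace α] [MeasurableSpace β]
    (S : α → β → ℝ) (μ : Measure α) (ν : Measure β)
    [IsProbabilityMeasure μ] [IsProbabilityMeasure ν] (R : ℝ)
    (h : ∀ π : Measure (α × β), IsProbabilityMeasure π → π.map Prod.fst = μ →
      π.map Prod.snd = ν → ∫ q, S q.1 q.2 ∂π ≤ R) : TS S μ ν ≤ R := by
  refine csSup_le ⟨_, μ.prod ν, inferInstance, by simp [Measure.map_fst_prod],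
    by simp [Measure.map_snd_prod], rfl⟩ ?_
  rintro r ⟨ρ, hρ, h₁, h₂, rfl⟩
  exact h ρ hρ h₁ h₂

/-- the equilibrium quality distribution solves the social planner's
problem. Let `(γ, price)` be a hedonic equilibrium with consumer distribution `Px`,
producer distribution `Py`, bounded upper semicontinuous utility `U` and bounded lower
semicontinuous cost `C`, and let `Pz` be the `z`-marginal of `γ`. Then `Pz` maximizes
`ν ↦ T_U(Px, ν) + T_{−C}(Py, ν)` over Borel probability measures `ν` on `Z`. -/
theorem stmt_16 {dx dz dy : ℕ}
    (Xt : Set (EuclideanSpace ℝ (Fin dx)))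
    (Z : Set (EuclideanSpace ℝ (Fin dz))) (hZc : IsCompact Z)
    (Yt : Set (EuclideanSpace ℝ (Fin dy)))
    (U : EuclideanSpace ℝ (Fin dx) → EuclideanSpace ℝ (Fin dz) → ℝ)
    (C : EuclideanSpace ℝ (Fin dy) → EuclideanSpace ℝ (Fin dz) → ℝ)
    (hUb : ∃ M : ℝ, ∀ x ∈ Xt, ∀ z ∈ Z, |U x z| ≤ M)
    (hCb : ∃ M : ℝ, ∀ y ∈ Yt, ∀ z ∈ Z, |C y z| ≤ M)
    (hUusc : UpperSemicontinuousOn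
      (fun q : EuclideanSpace ℝ (Fin dx) × EuclideanSpace ℝ (Fin dz) => U q.1 q.2) (Xt ×ˢ Z))
    (hClsc : LowerSemicontinuousOn
      (fun q : EuclideanSpace ℝ (Fin dy) × EuclideanSpace ℝ (Fin dz) => C q.1 q.2) (Yt ×ˢ Z))
    (hsel : ∃ sel : EuclideanSpace ℝ (Fin dx) × EuclideanSpace ℝ (Fin dy) →
        EuclideanSpace ℝ (Fin dz),
      Measurable sel ∧ ∀ x y, sel (x, y) ∈ Z ∧
        IsMaxOn (fun z => U x z - C y z) Z (sel (x, y)))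
    (Px : Measure (EuclideanSpace ℝ (Fin dx))) [IsProbabilityMeasure Px]
    (Py : Measure (EuclideanSpace ℝ (Fin dy))) [IsProbabilityMeasure Py]
    (hPx : ∀ᵐ x ∂Px, x ∈ Xt) (hPy : ∀ᵐ y ∂Py, y ∈ Yt)
    (price : EuclideanSpace ℝ (Fin dz) → ℝ)
    (γ : Measure (EuclideanSpace ℝ (Fin dx) × EuclideanSpace ℝ (Fin dz) ×
      EuclideanSpace ℝ (Fin dy)))
    (hγ : IsProbabilityMeasure γ)
    (hγx : γ.map (fun q => q.1) = Px)
    (hγy : γ.map (fun q => q.2.2) = Py)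
    (heqm : ∀ᵐ q ∂γ, q.2.1 ∈ Z ∧
      IsMaxOn (fun z' => U q.1 z' - price z') Z q.2.1 ∧
      IsMaxOn (fun z' => price z' - C q.2.2 z') Z q.2.1) :
    ∀ ν : Measure (EuclideanSpace ℝ (Fin dz)), IsProbabilityMeasure ν → ν Zᶜ = 0 →
      TS U Px ν + TS (fun y z => -C y z) Py ν
        ≤ TS U Px (γ.map (fun q => q.2.1))
          + TS (fun y z => -C y z) Py (γ.map (fun q => q.2.1)) := by
  intro ν hν hνZ
  obtain ⟨MU, hMU⟩ := hUb
  obtain ⟨MC, hMC⟩ := hCb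
  have hx : Measurable (fun q : EuclideanSpace ℝ (Fin dx) × EuclideanSpace ℝ (Fin dz) ×
      EuclideanSpace ℝ (Fin dy) => q.1) := by fun_prop
  have hz : Measurable (fun q : EuclideanSpace ℝ (Fin dx) × EuclideanSpace ℝ (Fin dz) ×
      EuclideanSpace ℝ (Fin dy) => q.2.1) := by fun_prop
  have hy : Measurable (fun q : EuclideanSpace ℝ (Fin dx) × EuclideanSpace ℝ (Fin dz) ×
      EuclideanSpace ℝ (Fin dy) => q.2.2) := by fun_prop
  have hxz : Measurable (fun q : EuclideanSpace ℝ (Fin dx) × EuclideanSpace ℝ (Fin dz) ×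
      EuclideanSpace ℝ (Fin dy) => (q.1, q.2.1)) := by fun_prop
  have hyz : Measurable (fun q : EuclideanSpace ℝ (Fin dx) × EuclideanSpace ℝ (Fin dz) ×
      EuclideanSpace ℝ (Fin dy) => (q.2.2, q.2.1)) := by fun_prop
  have hγX : ∀ᵐ q ∂γ, q.1 ∈ Xt := ae_of_ae_map hx.aemeasurable (hγx ▸ hPx)
  have hγY : ∀ᵐ q ∂γ, q.2.2 ∈ Yt := ae_of_ae_map hy.aemeasurable (hγy ▸ hPy)
  have hνZ' : ∀ᵐ z ∂ν, z ∈ Z := hνZ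
  have hPz : ∀ᵐ z ∂(γ.map (fun q => q.2.1)), z ∈ Z :=
    (ae_map_iff hz.aemeasurable hZc.measurableSet).2 (heqm.mono fun q hq => hq.1)
  have hUint : ∀ (π : Measure (EuclideanSpace ℝ (Fin dx) × EuclideanSpace ℝ (Fin dz))),
      IsProbabilityMeasure π → (∀ᵐ x ∂(π.map Prod.fst), x ∈ Xt) →
      (∀ᵐ z ∂(π.map Prod.snd), z ∈ Z) → Integrable (fun q => U q.1 q.2) π := by
    intro π _ h₁ h₂
    refine integrable_of_upperSemicontinuousOn (Xt ×ˢ Z) _ MU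
      (fun q hq => hMU _ hq.1 _ hq.2) hUusc π ?_
    filter_upwards [ae_of_ae_map measurable_fst.aemeasurable h₁,
      ae_of_ae_map measurable_snd.aemeasurable h₂] with q ha hb using ⟨ha, hb⟩
  have hCint : ∀ (π : Measure (EuclideanSpace ℝ (Fin dy) × EuclideanSpace ℝ (Fin dz))),
      IsProbabilityMeasure π → (∀ᵐ y ∂(π.map Prod.fst), y ∈ Yt) →
      (∀ᵐ z ∂(π.map Prod.snd), z ∈ Z) → Integrable (fun q => C q.1 q.2) π := by
    intro π _ h₁ h₂
    have h : Integrable (fun q => -C q.1 q.2) π := by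
      refine integrable_of_upperSemicontinuousOn (Yt ×ˢ Z) _ MC
        (fun q hq => by simpa using hMC _ hq.1 _ hq.2) ?_ π ?_
      · intro q hq r hr
        filter_upwards [hClsc q hq (-r) (by linarith)] with q' hq'
        linarith
      · filter_upwards [ae_of_ae_map measurable_fst.aemeasurable h₁,
          ae_of_ae_map measurable_snd.aemeasurable h₂] with q ha hb using ⟨ha, hb⟩
    simpa using h.neg
  -- the two couplings induced by the equilibrium
  have hprobxz : IsProbabilityMeasure (γ.map (fun q => (q.1, q.2.1))) :=
    Measure.isProbabilityMeasure_map hxz.aemeasurable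
  have hprobyz : IsProbabilityMeasure (γ.map (fun q => (q.2.2, q.2.1))) :=
    Measure.isProbabilityMeasure_map hyz.aemeasurable
  have hxz₁ : (γ.map (fun q => (q.1, q.2.1))).map Prod.fst = Px := by
    rw [Measure.map_map measurable_fst hxz, ← hγx]; rfl
  have hxz₂ : (γ.map (fun q => (q.1, q.2.1))).map Prod.snd = γ.map (fun q => q.2.1) := by
    rw [Measure.map_map measurable_snd hxz]; rfl
  have hyz₁ : (γ.map (fun q => (q.2.2, q.2.1))).map Prod.fst = Py := by
    rw [Measure.map_map measurable_fst hyz, ← hγy]; rfl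
  have hyz₂ : (γ.map (fun q => (q.2.2, q.2.1))).map Prod.snd = γ.map (fun q => q.2.1) := by
    rw [Measure.map_map measurable_snd hyz]; rfl
  have hUγ := hUint _ hprobxz (by rwa [hxz₁]) (by rwa [hxz₂])
  have hCγ := hCint _ hprobyz (by rwa [hyz₁]) (by rwa [hyz₂])
  have hUle := integral_le_TS U Px (γ.map (fun q => q.2.1)) Xt Z hPx hPz MU hMU _ hxz₁ hxz₂
  have hCle := integral_le_TS (fun y z => -C y z) Py (γ.map (fun q => q.2.1)) Yt Z hPy hPz MC
    (fun y hy z hz => by simpa using hMC y hy z hz) _ hyz₁ hyz₂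
  rw [integral_map hxz.aemeasurable hUγ.aestronglyMeasurable] at hUle
  rw [integral_neg, integral_map hyz.aemeasurable hCγ.aestronglyMeasurable] at hCle
  have hUγ' : Integrable (fun q => U q.1 q.2.1) γ := hUγ.comp_measurable hxz
  have hCγ' : Integrable (fun q => C q.2.2 q.2.1) γ := hCγ.comp_measurable hyz
  -- one equilibrium triple already bounds the price on `Z`
  obtain ⟨q₀, ⟨hz₀, hU₀, hC₀⟩, hx₀, hy₀⟩ := (heqm.and (hγX.and hγY)).exists
  have hVbdd : ∀ x ∈ Xt, BddAbove ((fun z => U x z - price z) '' Z) := by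
    refine fun x hx => ⟨2 * MU + (U q₀.1 q₀.2.1 - price q₀.2.1), ?_⟩
    rintro _ ⟨z, hz, rfl⟩
    have h₁ := abs_le.1 (hMU x hx z hz)
    have h₂ := abs_le.1 (hMU _ hx₀ z hz)
    have h₃ : U q₀.1 z - price z ≤ U q₀.1 q₀.2.1 - price q₀.2.1 := hU₀ hz
    dsimp only
    linarith [h₁.2, h₂.1]
  have hWbdd : ∀ y ∈ Yt, BddAbove ((fun z => price z - C y z) '' Z) := by
    refine fun y hy => ⟨2 * MC + (price q₀.2.1 - C q₀.2.2 q₀.2.1), ?_⟩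
    rintro _ ⟨z, hz, rfl⟩
    have h₁ := abs_le.1 (hMC y hy z hz)
    have h₂ := abs_le.1 (hMC _ hy₀ z hz)
    have h₃ : price z - C q₀.2.2 z ≤ price q₀.2.1 - C q₀.2.2 q₀.2.1 := hC₀ hz
    dsimp only
    linarith [h₁.1, h₂.2]
  have hVK : ∀ x ∈ Xt, |sSup ((fun z => U x z - price z) '' Z)| ≤ 3 * MU + |price q₀.2.1| := by
    intro x hx
    have hMU₀ := abs_le.1 (hMU x hx _ hz₀)
    have hMU₁ := abs_le.1 (hMU _ hx₀ _ hz₀)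
    have hp := neg_abs_le (price q₀.2.1)
    have hp' := le_abs_self (price q₀.2.1)
    refine abs_le.2 ⟨?_, csSup_le ⟨_, _, hz₀, rfl⟩ ?_⟩
    · have := le_csSup (hVbdd x hx) ⟨_, hz₀, rfl⟩
      dsimp only at this
      linarith [hMU₀.1, hMU₁.1, hMU₁.2]
    · rintro _ ⟨z, hz, rfl⟩
      have h₁ := abs_le.1 (hMU x hx z hz)
      have h₂ := abs_le.1 (hMU _ hx₀ z hz)
      have h₃ : U q₀.1 z - price z ≤ U q₀.1 q₀.2.1 - price q₀.2.1 := hU₀ hz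
      dsimp only
      linarith [h₁.2, h₂.1, hMU₁.2]
  have hmain : ∀ π₁ : Measure (EuclideanSpace ℝ (Fin dx) × EuclideanSpace ℝ (Fin dz)),
      IsProbabilityMeasure π₁ → π₁.map Prod.fst = Px → π₁.map Prod.snd = ν →
      ∀ π₂ : Measure (EuclideanSpace ℝ (Fin dy) × EuclideanSpace ℝ (Fin dz)),
      IsProbabilityMeasure π₂ → π₂.map Prod.fst = Py → π₂.map Prod.snd = ν →
      ∫ q, U q.1 q.2 ∂π₁ - ∫ q, C q.1 q.2 ∂π₂
        ≤ ∫ q, (U q.1 q.2.1 - C q.2.2 q.2.1) ∂γ := by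
    intro π₁ _ h₁x h₁z π₂ _ h₂y h₂z
    refine integral_sub_integral_le_of_potentials U C
      (fun x => sSup ((fun z => U x z - price z) '' Z)) price
      (fun y => sSup ((fun z => price z - C y z) '' Z)) γ π₁ π₂ (h₁x.trans hγx.symm)
      (h₂y.trans hγy.symm) (h₁z.trans h₂z.symm) (hUγ'.sub hCγ')
      (hUint π₁ inferInstance (by rwa [h₁x]) (by rwa [h₁z]))
      (hCint π₂ inferInstance (by rwa [h₂y]) (by rwa [h₂z])) ?_ ?_ ?_
      (3 * MU + |price q₀.2.1|) ?_
    · filter_upwards [heqm] with q hq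
      obtain ⟨hqz, hqU, hqC⟩ := hq
      have h₁ : sSup ((fun z => U q.1 z - price z) '' Z) ≤ U q.1 q.2.1 - price q.2.1 :=
        csSup_le ⟨_, _, hqz, rfl⟩ (by rintro _ ⟨z, hz, rfl⟩; exact hqU hz)
      have h₂ : sSup ((fun z => price z - C q.2.2 z) '' Z) ≤ price q.2.1 - C q.2.2 q.2.1 :=
        csSup_le ⟨_, _, hqz, rfl⟩ (by rintro _ ⟨z, hz, rfl⟩; exact hqC hz)
      linarith
    · filter_upwards [ae_of_ae_map measurable_fst.aemeasurable (h₁x ▸ hPx),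
        ae_of_ae_map measurable_snd.aemeasurable (h₁z ▸ hνZ')] with q ha hb
      exact le_csSup (hVbdd _ ha) ⟨_, hb, rfl⟩
    · filter_upwards [ae_of_ae_map measurable_fst.aemeasurable (h₂y ▸ hPy),
        ae_of_ae_map measurable_snd.aemeasurable (h₂z ▸ hνZ')] with q ha hb
      exact le_csSup (hWbdd _ ha) ⟨_, hb, rfl⟩
    · change ∀ᵐ x ∂(γ.map (fun q => q.1)), _
      rw [hγx]
      exact hPx.mono hVK
  rw [integral_sub hUγ' hCγ'] at hmain
  refine le_trans ?_ (add_le_add hUle hCle)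
  rw [← le_sub_iff_add_le]
  refine TS_le _ _ _ _ fun π₁ hπ₁ h₁x h₁z => ?_
  rw [le_sub_comm]
  refine TS_le _ _ _ _ fun π₂ hπ₂ h₂y h₂z => ?_
  rw [integral_neg]
  linarith [hmain π₁ hπ₁ h₁x h₁z π₂ hπ₂ h₂y h₂z]
end
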